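/- arXiv:math/0303066 — 4 statements merged into one kernel-verified Lean document; each statement's English description precedes it below -/
import Mathlib

section
/- Suppose in addition that a is even and n is even (so that R_n(k) is well defined with k + n/2 an integer shift; n ranges over positive integers). Then there exist rational numbers κ₀, κ₃, κ₅, …, κ_{a−1} (depending on n, a, r) such that: (1) S_n(1) = κ₀ + κ₃·ζ(3) + κ₅·ζ(5) + ⋯ + κ_{a−1}·ζ(a−1); (2) for every j ∈ {0, 3, 5, …, a−1}, limsup_{n→∞} |κ_j|^{1/n} ≤ 2^{a−2r}(2r+1)^{2r+1}; (3) for every j ∈ {0, 3, 5, …, a−1}, the rational number d_n^a·κ_j is an integer; (4) there exists a real number ψ_{r,a} > 0 such that lim_{n→∞} |S_n(1)|^{1/n} = ψ_{r,a} ≤ 2^{r+1}/r^{a−2r}. -/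
open Filter

/-- The values of the Riemann zeta function at integers `s ≥ 2`,
as a real number: `ζ(s) = ∑_{n ≥ 1} n^{-s}`. -/
noncomputable def zetaR (s : ℕ) : ℝ := ∑' n : ℕ, 1 / (n + 1 : ℝ) ^ s

/-- The Pochhammer symbol `(x)_m = x(x+1)⋯(x+m-1)` on the reals. -/
noncomputable def poch (x : ℝ) (m : ℕ) : ℝ := ∏ i ∈ Finset.range m, (x + i)

/-- The rational function
`R_n(k) = 2·n!^{a-2r}·(k + n/2)·(k-rn)_{rn}·(k+n+1)_{rn} / ((k)_{n+1})^a`. -/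
noncomputable def RR (a r n : ℕ) (k : ℝ) : ℝ :=
  2 * (n.factorial : ℝ) ^ (a - 2 * r) * (k + n / 2) *
    poch (k - r * n) (r * n) * poch (k + n + 1) (r * n) / (poch k (n + 1)) ^ a

/-- The series `S_n(z) = ∑_{k ≥ 1} R_n(k) z^{-k}` for `|z| ≥ 1`. -/
noncomputable def SS (a r n : ℕ) (z : ℝ) : ℝ := ∑' k : ℕ, RR a r n (k + 1) / z ^ (k + 1)

/-- `d_n`: the least common multiple of `1, 2, …, n`. -/
def dlcm (n : ℕ) : ℕ := (Finset.Icc 1 n).lcm id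

/-- The relevant index set `{0, 3, 5, 7, …, a-1}`. -/
def idxSet (a : ℕ) : Set ℕ := {0} ∪ {j : ℕ | Odd j ∧ 3 ≤ j ∧ j ≤ a - 1}

namespace Rivoal

/-- The exponential growth rate of the summand `RR a r n (q + 1)` at `q = x n`. -/
noncomputable def rate (a r : ℕ) (x : ℝ) : ℝ :=
  x * Real.log x - (x - r) * Real.log (x - r) + (x + 1 + r) * Real.log (x + 1 + r)
    - (x + 1) * Real.log (x + 1) + a * (x * Real.log x - (x + 1) * Real.log (x + 1))

lemma le_log_factorial (m : ℕ) :
    (m : ℝ) * Real.log m - m ≤ Real.log (m.factorial : ℝ) := by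
  induction m with
  | zero => simp
  | succ m ih =>
    rcases Nat.eq_zero_or_pos m with rfl | hm
    · simp
    have hm' : (0 : ℝ) < m := by exact_mod_cast hm
    have h1 : Real.log ((m + 1).factorial : ℝ) = Real.log (m + 1 : ℝ) + Real.log m.factorial := by
      rw [Nat.factorial_succ]
      push_cast
      rw [Real.log_mul (by positivity) (by positivity)]
    have h2 : Real.log (m + 1 : ℝ) - Real.log m ≤ 1 / m := by
      rw [← Real.log_div (by positivity) (by positivity)]
      refine (Real.log_le_sub_one_of_pos (by positivity)).trans (le_of_eq ?_)
      field_simp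
      ring
    have h3 : (m : ℝ) * (Real.log (m + 1 : ℝ) - Real.log m) ≤ 1 := by
      calc _ ≤ (m : ℝ) * (1 / m) := by gcongr
        _ = 1 := by field_simp
    rw [h1]
    push_cast
    nlinarith

lemma log_factorial_le (m : ℕ) :
    Real.log (m.factorial : ℝ) ≤ (m : ℝ) * Real.log m - m + 1 + Real.log (m + 1) := by
  have key : ∀ m : ℕ, Real.log ((m + 1).factorial : ℝ) ≤
      (m + 1 : ℝ) * Real.log (m + 1) - (m + 1) + 1 + Real.log (m + 1) := by
    intro m
    induction m with
    | zero => simp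
    | succ m ih =>
      have hm' : (0 : ℝ) < (m : ℝ) + 1 := by positivity
      have h1 : Real.log ((m + 1 + 1).factorial : ℝ) =
          Real.log (m + 1 + 1 : ℝ) + Real.log (m + 1).factorial := by
        rw [Nat.factorial_succ (m + 1)]
        push_cast
        rw [Real.log_mul (by positivity) (by positivity)]
      have h2 : Real.log (m + 1 : ℝ) - Real.log (m + 1 + 1) ≤ - (1 / (m + 1 + 1 : ℝ)) := by
        rw [← Real.log_div (by positivity) (by positivity)]
        refine (Real.log_le_sub_one_of_pos (by positivity)).trans (le_of_eq ?_)
        field_simp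
        ring
      have h3 : ((m : ℝ) + 1 + 1) * (Real.log (m + 1 : ℝ) - Real.log (m + 1 + 1)) ≤ -1 := by
        calc _ ≤ ((m : ℝ) + 1 + 1) * (- (1 / (m + 1 + 1 : ℝ))) := by gcongr
          _ = -1 := by field_simp
      rw [h1]
      push_cast
      nlinarith
  rcases m with _ | m
  · simp
  · refine (key m).trans ?_
    push_cast
    have : Real.log ((m : ℝ) + 1) ≤ Real.log ((m : ℝ) + 1 + 1) :=
      Real.log_le_log (by positivity) (by linarith)
    linarith

lemma poch_mul_factorial (m t : ℕ) :
    poch ((m : ℝ) + 1) t * (m.factorial : ℝ) = ((m + t).factorial : ℝ) := by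
  induction t with
  | zero => simp [poch]
  | succ t ih =>
    unfold poch at ih ⊢
    rw [Finset.prod_range_succ, ← add_assoc, Nat.factorial_succ]
    push_cast
    rw [← ih]
    ring

lemma poch_eq_div (m t : ℕ) :
    poch ((m : ℝ) + 1) t = ((m + t).factorial : ℝ) / (m.factorial : ℝ) := by
  rw [← poch_mul_factorial]
  field_simp

lemma RR_eq_zero {a r n q : ℕ} (hq : q < r * n) : RR a r n (q + 1) = 0 := by
  have : poch ((q : ℝ) + 1 - r * n) (r * n) = 0 := by
    unfold poch
    refine Finset.prod_eq_zero (i := r * n - (q + 1)) (Finset.mem_range.2 (by omega)) ?_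
    rw [Nat.cast_sub (by omega)]
    push_cast
    ring
  unfold RR
  rw [this]
  simp

lemma RR_eq_factorial (a r n l : ℕ) :
    RR a r n ((r * n + l : ℕ) + 1) = 2 * (n.factorial : ℝ) ^ (a - 2 * r) *
      ((r * n + l : ℕ) + 1 + n / 2) * (((r * n + l).factorial : ℝ) / l.factorial) *
      (((r * n + l + n + r * n).factorial : ℝ) / (r * n + l + n).factorial) *
      (((r * n + l : ℕ) + 1 + n + r * n) / ((r * n + l : ℕ) + 1 + n)) *
      (((r * n + l).factorial : ℝ) / (r * n + l + n).factorial / ((r * n + l : ℕ) + 1 + n)) ^ a := by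
  have e1 : poch (((r * n + l : ℕ) : ℝ) + 1 - r * n) (r * n)
      = ((r * n + l).factorial : ℝ) / l.factorial := by
    rw [add_comm (r * n) l, ← poch_eq_div]
    congr 1
    push_cast
    ring
  have e2 : poch (((r * n + l : ℕ) : ℝ) + 1 + n + 1) (r * n)
      = (((r * n + l + n + r * n).factorial : ℝ) / (r * n + l + n).factorial) *
      (((r * n + l : ℕ) + 1 + n + r * n) / ((r * n + l : ℕ) + 1 + n)) := by
    have : (((r * n + l : ℕ) : ℝ) + 1 + n + 1) = ((r * n + l + n + 1 : ℕ) : ℝ) + 1 := by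
      push_cast; ring
    rw [this, poch_eq_div, show r * n + l + n + 1 + r * n = (r * n + l + n + r * n) + 1 by ring,
      Nat.factorial_succ, Nat.factorial_succ]
    push_cast
    field_simp
    ring
  have e3 : poch (((r * n + l : ℕ) : ℝ) + 1) (n + 1)
      = ((((r * n + l).factorial : ℝ) / (r * n + l + n).factorial
        / ((r * n + l : ℕ) + 1 + n)))⁻¹ := by
    rw [poch_eq_div, ← add_assoc, Nat.factorial_succ]
    push_cast
    field_simp
    ring
  unfold RR
  rw [e1, e2, e3, inv_pow, div_inv_eq_mul]
  ring

lemma RR_pos (a r n l : ℕ) : 0 < RR a r n ((r * n + l : ℕ) + 1) := by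
  rw [RR_eq_factorial]
  positivity

lemma RR_nonneg (a r n q : ℕ) : 0 ≤ RR a r n (q + 1) := by
  rcases lt_or_ge q (r * n) with h | h
  · exact (RR_eq_zero h).ge
  · obtain ⟨l, rfl⟩ := Nat.exists_eq_add_of_le h
    exact (RR_pos a r n l).le

lemma mul_rate {a r n q : ℕ} (hra : 2 * r < a) (hn : 1 ≤ n) (hq : r * n ≤ q) :
    n * rate a r (q / n) = (q * Real.log q - q)
      - (((q - r * n : ℕ) : ℝ) * Real.log (q - r * n : ℕ) - (q - r * n : ℕ))
      + (((q + n + r * n : ℕ) : ℝ) * Real.log (q + n + r * n : ℕ) - (q + n + r * n : ℕ))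
      - (((q + n : ℕ) : ℝ) * Real.log (q + n : ℕ) - (q + n : ℕ))
      + a * ((q * Real.log q - q) - (((q + n : ℕ) : ℝ) * Real.log (q + n : ℕ) - (q + n : ℕ)))
      + ((a - 2 * r : ℕ) : ℝ) * (n * Real.log n - n) := by
  have hn' : (0 : ℝ) < n := by exact_mod_cast hn
  have key : ∀ m : ℕ, (n : ℝ) * ((m / n : ℝ) * Real.log (m / n)) =
      m * Real.log m - m * Real.log n := by
    intro m
    rcases Nat.eq_zero_or_pos m with rfl | hm
    · simp
    rw [Real.log_div (by positivity) (by positivity)]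
    field_simp
  have h1 : (q / n : ℝ) - r = ((q - r * n : ℕ) : ℝ) / n := by
    rw [Nat.cast_sub hq]; push_cast; field_simp
  have h2 : (q / n : ℝ) + 1 + r = ((q + n + r * n : ℕ) : ℝ) / n := by
    push_cast; field_simp
  have h3 : (q / n : ℝ) + 1 = ((q + n : ℕ) : ℝ) / n := by
    push_cast; field_simp
  have : (n : ℝ) * rate a r (q / n) =
      (n : ℝ) * ((q / n : ℝ) * Real.log (q / n))
      - (n : ℝ) * ((((q - r * n : ℕ) : ℝ) / n) * Real.log (((q - r * n : ℕ) : ℝ) / n))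
      + (n : ℝ) * ((((q + n + r * n : ℕ) : ℝ) / n) * Real.log (((q + n + r * n : ℕ) : ℝ) / n))
      - (n : ℝ) * ((((q + n : ℕ) : ℝ) / n) * Real.log (((q + n : ℕ) : ℝ) / n))
      + a * ((n : ℝ) * ((q / n : ℝ) * Real.log (q / n)) -
         (n : ℝ) * ((((q + n : ℕ) : ℝ) / n) * Real.log (((q + n : ℕ) : ℝ) / n))) := by
    unfold rate
    rw [h1, h2, h3]
    ring
  rw [this, key, key, key, key, Nat.cast_sub hra.le, Nat.cast_sub hq]
  push_cast
  ring

lemma log_RR {a r n q : ℕ} (hq : r * n ≤ q) :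
    Real.log (RR a r n (q + 1)) = Real.log 2 + ((a - 2 * r : ℕ) : ℝ) * Real.log n.factorial
      + Real.log (q + 1 + n / 2) + (Real.log q.factorial - Real.log (q - r * n).factorial)
      + (Real.log (q + n + r * n).factorial - Real.log (q + n).factorial)
      + (Real.log (q + 1 + n + r * n) - Real.log (q + 1 + n))
      + a * (Real.log q.factorial - Real.log (q + n).factorial - Real.log (q + 1 + n)) := by
  obtain ⟨l, rfl⟩ := Nat.exists_eq_add_of_le hq
  rw [RR_eq_factorial, Real.log_mul (by positivity) (by positivity),
    Real.log_mul (by positivity) (by positivity), Real.log_mul (by positivity) (by positivity),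
    Real.log_mul (by positivity) (by positivity), Real.log_mul (by positivity) (by positivity),
    Real.log_mul (by positivity) (by positivity), Real.log_pow, Real.log_pow,
    Real.log_div (by positivity) (by positivity), Real.log_div (by positivity) (by positivity),
    Real.log_div (by positivity) (by positivity), Real.log_div (by positivity) (by positivity),
    Real.log_div (by positivity) (by positivity), Nat.add_sub_cancel_left]

lemma abs_log_RR_sub_le {a r n q : ℕ} (hra : 2 * r < a) (hn : 1 ≤ n) (hq : r * n ≤ q) :
    |Real.log (RR a r n (q + 1)) - n * rate a r (q / n)| ≤
      (2 * a + 5) * (1 + Real.log (q + n + r * n + 2)) := by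
  set L : ℝ := Real.log (q + n + r * n + 2) with hL
  have hL0 : 0 ≤ L := Real.log_nonneg (by
    have : (0 : ℝ) ≤ q + n + r * n := by positivity
    linarith)
  have hlog : ∀ y : ℝ, 1 ≤ y → y ≤ q + n + r * n + 2 → 0 ≤ Real.log y ∧ Real.log y ≤ L :=
    fun y h1 h2 => ⟨Real.log_nonneg h1, Real.log_le_log (by linarith) h2⟩
  have hfac : ∀ m : ℕ, m ≤ q + n + r * n → 0 ≤ Real.log m.factorial - (m * Real.log m - m) ∧
      Real.log m.factorial - (m * Real.log m - m) ≤ 1 + L := by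
    intro m hm
    have h1 := le_log_factorial m
    have h2 := log_factorial_le m
    have hm' : (m : ℝ) ≤ q + n + r * n := by exact_mod_cast hm
    have h3 := hlog (m + 1) (by simp) (by linarith)
    constructor <;> linarith [h3.2]
  have hq0 : (0 : ℝ) ≤ q := by positivity
  have hn0 : (0 : ℝ) ≤ n := by positivity
  have hrn : (0 : ℝ) ≤ r * n := by positivity
  have g2 : 0 ≤ Real.log 2 ∧ Real.log 2 ≤ L := hlog 2 (by norm_num) (by linarith)
  have g3 := hlog (q + 1 + n / 2) (by linarith) (by linarith)
  have g4 := hlog (q + 1 + n + r * n) (by linarith) (by linarith)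
  have g5 := hlog (q + 1 + n) (by linarith) (by linarith)
  have f1 := hfac n (by omega)
  have f2 := hfac q (by omega)
  have f3 := hfac (q - r * n) (by omega)
  have f4 := hfac (q + n + r * n) le_rfl
  have f5 := hfac (q + n) (by omega)
  rw [log_RR hq, mul_rate hra hn hq]
  have ha0 : (0 : ℝ) ≤ a := by positivity
  have hb0 : (0 : ℝ) ≤ ((a - 2 * r : ℕ) : ℝ) := by positivity
  have hba : ((a - 2 * r : ℕ) : ℝ) ≤ a := by exact_mod_cast Nat.sub_le _ _
  set e1 := Real.log n.factorial - (n * Real.log n - n)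
  set e2 := Real.log q.factorial - (q * Real.log q - q)
  set e3 := Real.log (q - r * n).factorial -
    (((q - r * n : ℕ) : ℝ) * Real.log (q - r * n : ℕ) - (q - r * n : ℕ))
  set e4 := Real.log (q + n + r * n).factorial -
    (((q + n + r * n : ℕ) : ℝ) * Real.log (q + n + r * n : ℕ) - (q + n + r * n : ℕ))
  set e5 := Real.log (q + n).factorial -
    (((q + n : ℕ) : ℝ) * Real.log (q + n : ℕ) - (q + n : ℕ))
  have h1 := mul_le_mul hba f1.2 f1.1 ha0
  have h1' := mul_nonneg hb0 f1.1
  have h2 := mul_le_mul_of_nonneg_left f2.2 ha0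
  have h2' := mul_nonneg ha0 f2.1
  have h5 := mul_le_mul_of_nonneg_left f5.2 ha0
  have h5' := mul_nonneg ha0 f5.1
  have h6 := mul_le_mul_of_nonneg_left g5.2 ha0
  have h6' := mul_nonneg ha0 g5.1
  have haL := mul_nonneg ha0 hL0
  have : (Real.log 2 + ((a - 2 * r : ℕ) : ℝ) * Real.log n.factorial
      + Real.log (q + 1 + n / 2) + (Real.log q.factorial - Real.log (q - r * n).factorial)
      + (Real.log (q + n + r * n).factorial - Real.log (q + n).factorial)
      + (Real.log (q + 1 + n + r * n) - Real.log (q + 1 + n))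
      + a * (Real.log q.factorial - Real.log (q + n).factorial - Real.log (q + 1 + n))) -
      ((q * Real.log q - q)
      - (((q - r * n : ℕ) : ℝ) * Real.log (q - r * n : ℕ) - (q - r * n : ℕ))
      + (((q + n + r * n : ℕ) : ℝ) * Real.log (q + n + r * n : ℕ) - (q + n + r * n : ℕ))
      - (((q + n : ℕ) : ℝ) * Real.log (q + n : ℕ) - (q + n : ℕ))
      + a * ((q * Real.log q - q) - (((q + n : ℕ) : ℝ) * Real.log (q + n : ℕ) - (q + n : ℕ)))
      + ((a - 2 * r : ℕ) : ℝ) * (n * Real.log n - n)) =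
      Real.log 2 + ((a - 2 * r : ℕ) : ℝ) * e1 + Real.log (q + 1 + n / 2) + e2 - e3 + e4 - e5
      + (Real.log (q + 1 + n + r * n) - Real.log (q + 1 + n)) + a * e2 - a * e5
      - a * Real.log (q + 1 + n) := by
    simp only [e1, e2, e3, e4, e5]
    ring
  rw [this, abs_le]
  constructor <;> linarith [g2.1, g2.2, g3.1, g3.2, g4.1, g4.2, g5.1, g5.2, f2.1, f2.2, f3.1,
    f3.2, f4.1, f4.2, f5.1, f5.2]

lemma RR_bounds {a r n q : ℕ} (hr : 1 ≤ r) (hra : 2 * r < a) (hn : 1 ≤ n) (hq : r * n ≤ q) :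
    Real.exp (n * rate a r (q / n)) ≤ (15 * (q + 1 : ℝ)) ^ (2 * a + 5) * RR a r n (q + 1) ∧
    RR a r n (q + 1) ≤ (15 * (q + 1 : ℝ)) ^ (2 * a + 5) * Real.exp (n * rate a r (q / n)) := by
  have hpos : 0 < RR a r n (q + 1) := by
    obtain ⟨l, rfl⟩ := Nat.exists_eq_add_of_le hq
    exact RR_pos a r n l
  have h := abs_le.1 (abs_log_RR_sub_le hra hn hq)
  have hexp : Real.exp ((2 * a + 5) * (1 + Real.log (q + n + r * n + 2))) ≤
      (15 * (q + 1 : ℝ)) ^ (2 * a + 5) := by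
    have hnq : n ≤ q := (Nat.le_mul_of_pos_left n hr).trans hq
    have hnq' : (n : ℝ) ≤ q := by exact_mod_cast hnq
    have hq' : (r * n : ℝ) ≤ q := by exact_mod_cast hq
    have hrn : (0 : ℝ) ≤ r * n := by positivity
    have : ((2 * a + 5 : ℝ)) = ((2 * a + 5 : ℕ) : ℝ) := by push_cast; ring
    rw [this, Real.exp_nat_mul, Real.exp_add, Real.exp_log (by positivity)]
    refine pow_le_pow_left₀ (by positivity) ?_ _
    have h3 : Real.exp 1 ≤ 3 := Real.exp_one_lt_three.le
    calc Real.exp 1 * (q + n + r * n + 2) ≤ 3 * (q + q + q + 2) := by gcongr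
      _ ≤ 15 * (q + 1) := by linarith
  have hRR := Real.exp_log hpos
  constructor
  · calc Real.exp (n * rate a r (q / n)) ≤
        Real.exp ((2 * a + 5) * (1 + Real.log (q + n + r * n + 2)) + Real.log (RR a r n (q + 1))) :=
          Real.exp_le_exp.2 (by linarith [h.1])
      _ ≤ _ := by
        rw [Real.exp_add, hRR]
        gcongr
  · calc RR a r n (q + 1) = Real.exp (Real.log (RR a r n (q + 1))) := hRR.symm
      _ ≤ Real.exp ((2 * a + 5) * (1 + Real.log (q + n + r * n + 2)) + n * rate a r (q / n)) :=
          Real.exp_le_exp.2 (by linarith [h.2])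
      _ ≤ _ := by
        rw [Real.exp_add]
        gcongr

lemma continuous_rate (a r : ℕ) : Continuous (rate a r) := by
  have h := Real.continuous_mul_log
  have h1 : Continuous fun x : ℝ => (x - r) * Real.log (x - r) :=
    h.comp (continuous_id.sub continuous_const)
  have h2 : Continuous fun x : ℝ => (x + 1 + r) * Real.log (x + 1 + r) :=
    h.comp ((continuous_id.add continuous_const).add continuous_const)
  have h3 : Continuous fun x : ℝ => (x + 1) * Real.log (x + 1) :=
    h.comp (continuous_id.add continuous_const)
  unfold rate
  exact (((h.sub h1).add h2).sub h3).add (continuous_const.mul (h.sub h3))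

/-- The gradient inequality for the convex function `x ↦ x log x`. -/
lemma mul_log_sub_mul_log_le {x y : ℝ} (hx : 0 < x) (hy : 0 ≤ y) :
    x * Real.log x - y * Real.log y ≤ (x - y) * (Real.log x + 1) := by
  rcases hy.eq_or_lt with rfl | hy
  · simp
    nlinarith
  have h := Real.log_le_sub_one_of_pos (div_pos hx hy)
  rw [Real.log_div hx.ne' hy.ne'] at h
  have h2 := mul_le_mul_of_nonneg_left h hy.le
  have h3 : y * (x / y - 1) = x - y := by field_simp
  nlinarith

lemma rate_le {a r : ℕ} (hr : 1 ≤ r) (hra : 2 * r < a) {x : ℝ} (hx : (r : ℝ) ≤ x) :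
    rate a r x ≤ r * Real.log ((x + 1 + r) / x) - ((a - 2 * r : ℕ) : ℝ) * (Real.log x + 1) := by
  have hr' : (1 : ℝ) ≤ r := by exact_mod_cast hr
  have hx0 : 0 < x := by linarith
  have h1 := mul_log_sub_mul_log_le hx0 (sub_nonneg.2 hx)
  have h2 := mul_log_sub_mul_log_le (x := x + 1 + r) (y := x + 1) (by linarith) (by linarith)
  have h3 := mul_log_sub_mul_log_le (x := x) (y := x + 1) hx0 (by linarith)
  have h4 := mul_le_mul_of_nonneg_left h3 (Nat.cast_nonneg (α := ℝ) a)
  rw [Real.log_div (by linarith) hx0.ne', Nat.cast_sub hra.le]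
  unfold rate
  push_cast
  linarith

lemma rate_le_sub_log {a r : ℕ} (hr : 1 ≤ r) (hra : 2 * r < a) {x : ℝ} (hx : (r : ℝ) ≤ x) :
    rate a r x ≤ r * Real.log 3 - Real.log x := by
  have hr' : (1 : ℝ) ≤ r := by exact_mod_cast hr
  have hx0 : 0 < x := by linarith
  refine (rate_le hr hra hx).trans ?_
  have h1 : Real.log ((x + 1 + r) / x) ≤ Real.log 3 := by
    refine Real.log_le_log (by positivity) ?_
    rw [div_le_iff₀ hx0]
    linarith
  have h2 : (0 : ℝ) ≤ Real.log x := Real.log_nonneg (by linarith)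
  have h3 : (1 : ℝ) ≤ ((a - 2 * r : ℕ) : ℝ) := by
    exact_mod_cast (by omega : 1 ≤ a - 2 * r)
  have h4 := mul_le_mul_of_nonneg_left h1 (by linarith : (0 : ℝ) ≤ r)
  nlinarith

lemma rate_le_log {a r : ℕ} (hr : 1 ≤ r) (hra : 2 * r + 2 ≤ a) {x : ℝ} (hx : (r : ℝ) ≤ x) :
    rate a r x ≤ Real.log (2 ^ (r + 1) / (r : ℝ) ^ (a - 2 * r)) := by
  have hr' : (1 : ℝ) ≤ r := by exact_mod_cast hr
  have hx0 : 0 < x := by linarith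
  refine (rate_le hr (by omega) hx).trans ?_
  rw [Real.log_div (x := 2 ^ (r + 1)) (by positivity) (by positivity), Real.log_pow, Real.log_pow]
  have h1 : Real.log ((x + 1 + r) / x) ≤ Real.log 2 + 1 / (2 * r) := by
    have : (x + 1 + r) / x ≤ 2 * (1 + 1 / (2 * r)) := by
      rw [div_le_iff₀ hx0]
      have : (1 : ℝ) ≤ x / r := (one_le_div (by linarith)).2 hx
      have e : 2 * (1 + 1 / (2 * (r : ℝ))) * x = 2 * x + x / r := by
        field_simp
      linarith
    refine (Real.log_le_log (by positivity) this).trans ?_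
    rw [Real.log_mul (by positivity) (by positivity)]
    have := Real.log_le_sub_one_of_pos (x := 1 + 1 / (2 * (r : ℝ))) (by positivity)
    linarith
  have h2 : Real.log r ≤ Real.log x := Real.log_le_log (by linarith) hx
  have h3 : (2 : ℝ) ≤ ((a - 2 * r : ℕ) : ℝ) := by
    exact_mod_cast (by omega : 2 ≤ a - 2 * r)
  have h4 := mul_le_mul_of_nonneg_left h1 (by linarith : (0 : ℝ) ≤ r)
  have h5 : (r : ℝ) * (Real.log 2 + 1 / (2 * r)) = r * Real.log 2 + 1 / 2 := by field_simp
  have h6 := mul_le_mul_of_nonneg_left h2 (by linarith : (0 : ℝ) ≤ ((a - 2 * r : ℕ) : ℝ))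
  have h7 : 0 ≤ Real.log 2 := Real.log_nonneg (by norm_num)
  push_cast
  nlinarith

/-- The supremum of the growth rate of the summands. -/
noncomputable def maxRate (a r : ℕ) : ℝ := sSup (rate a r '' Set.Ici (r : ℝ))

lemma rate_le_maxRate {a r : ℕ} (hr : 1 ≤ r) (hra : 2 * r + 2 ≤ a) {x : ℝ} (hx : (r : ℝ) ≤ x) :
    rate a r x ≤ maxRate a r := by
  refine le_csSup ⟨Real.log (2 ^ (r + 1) / (r : ℝ) ^ (a - 2 * r)), ?_⟩ ⟨x, hx, rfl⟩
  rintro _ ⟨y, hy, rfl⟩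
  exact rate_le_log hr hra hy

lemma maxRate_le {a r : ℕ} (hr : 1 ≤ r) (hra : 2 * r + 2 ≤ a) :
    maxRate a r ≤ Real.log (2 ^ (r + 1) / (r : ℝ) ^ (a - 2 * r)) := by
  refine csSup_le ⟨_, (r : ℝ), Set.self_mem_Ici, rfl⟩ ?_
  rintro _ ⟨y, hy, rfl⟩
  exact rate_le_log hr hra hy

lemma RR_le_div_sq {a r n : ℕ} (hr : 1 ≤ r) (hra : 2 * r + 2 ≤ a) (hn : 2 * a + 7 ≤ n) (q : ℕ) :
    RR a r n (q + 1) ≤ (30 ^ (2 * a + 5) * 3 ^ (r * (2 * a + 7)) * (n : ℝ) ^ (2 * a + 7) *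
      Real.exp (((n : ℝ) - (2 * a + 7 : ℕ)) * maxRate a r)) * (1 / (q : ℝ) ^ 2) := by
  rcases lt_or_ge q (r * n) with hq | hq
  · rw [RR_eq_zero hq]
    positivity
  have hn0 : 1 ≤ n := by omega
  have hnq : n ≤ q := (Nat.le_mul_of_pos_left n hr).trans hq
  have hn' : (0 : ℝ) < n := by exact_mod_cast hn0
  have hq1 : (1 : ℝ) ≤ q := by exact_mod_cast hn0.trans hnq
  have hx : (r : ℝ) ≤ q / n := by
    rw [le_div_iff₀ hn']
    exact_mod_cast hq
  have h1 := (RR_bounds (a := a) hr (by omega) hn0 hq).2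
  have hnD : (0 : ℝ) ≤ (n : ℝ) - (2 * a + 7 : ℕ) := by
    rw [sub_nonneg]
    exact_mod_cast hn
  have h2 : n * rate a r (q / n) ≤ ((n : ℝ) - (2 * a + 7 : ℕ)) * maxRate a r +
      (2 * a + 7 : ℕ) * (r * Real.log 3 - Real.log (q / n)) := by
    have e1 := mul_le_mul_of_nonneg_left (rate_le_maxRate hr hra hx) hnD
    have e2 := mul_le_mul_of_nonneg_left (rate_le_sub_log (a := a) hr (by omega) hx)
      (Nat.cast_nonneg (α := ℝ) (2 * a + 7))
    linarith
  have h3 : Real.exp ((2 * a + 7 : ℕ) * (r * Real.log 3 - Real.log (q / n))) =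
      3 ^ (r * (2 * a + 7)) * (n : ℝ) ^ (2 * a + 7) / (q : ℝ) ^ (2 * a + 7) := by
    rw [Real.exp_nat_mul, Real.exp_sub, Real.exp_nat_mul, Real.exp_log (by norm_num),
      Real.exp_log (by positivity), div_pow, div_pow, pow_mul]
    field_simp
  calc RR a r n (q + 1) ≤ _ := h1
    _ ≤ (15 * (q + q : ℝ)) ^ (2 * a + 5) * Real.exp (((n : ℝ) - (2 * a + 7 : ℕ)) * maxRate a r +
      (2 * a + 7 : ℕ) * (r * Real.log 3 - Real.log (q / n))) := by gcongr
    _ = _ := by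
      rw [Real.exp_add, h3, show (15 * (q + q : ℝ)) = 30 * q by ring, mul_pow, pow_add (q : ℝ) (2 * a + 5) 2]
      field_simp

lemma summable_RR {a r n : ℕ} (hr : 1 ≤ r) (hra : 2 * r + 2 ≤ a) (hn : 2 * a + 7 ≤ n) :
    Summable fun q : ℕ => RR a r n (q + 1) :=
  Summable.of_nonneg_of_le (RR_nonneg a r n) (RR_le_div_sq hr hra hn)
    ((Real.summable_one_div_nat_pow.2 (by norm_num)).mul_left _)

lemma SS_one (a r n : ℕ) : SS a r n 1 = ∑' q : ℕ, RR a r n (q + 1) := by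
  simp [SS]

lemma tendsto_const_mul_pow_rpow_inv {C : ℝ} (hC : 0 < C) (D : ℕ) :
    Tendsto (fun n : ℕ => (C * (n : ℝ) ^ D) ^ (1 / (n : ℝ))) atTop (nhds 1) := by
  have h1 : Tendsto (fun n : ℕ => C ^ (1 / (n : ℝ))) atTop (nhds 1) := by
    have := tendsto_one_div_atTop_nhds_zero_nat (𝕜 := ℝ)
    simpa using tendsto_const_nhds.rpow this (Or.inl hC.ne')
  have h2 : Tendsto (fun n : ℕ => ((n : ℝ) ^ (1 / (n : ℝ))) ^ D) atTop (nhds 1) := by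
    have := (tendsto_rpow_div.comp (tendsto_natCast_atTop_atTop (R := ℝ))).pow D
    simpa using this
  have h3 := h1.mul h2
  rw [one_mul] at h3
  refine h3.congr fun n => ?_
  rw [Real.mul_rpow hC.le (by positivity), ← Real.rpow_natCast, ← Real.rpow_natCast,
    ← Real.rpow_mul (by positivity), ← Real.rpow_mul (by positivity), mul_comm (D : ℝ)]

lemma exp_mul_rpow_one_div {n : ℕ} (hn : n ≠ 0) (y : ℝ) :
    Real.exp (n * y) ^ (1 / (n : ℝ)) = Real.exp y := by
  rw [← Real.exp_mul]
  congr 1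
  field_simp

lemma exists_SS_rpow_le {a r : ℕ} (hr : 1 ≤ r) (hra : 2 * r + 2 ≤ a) :
    ∃ u : ℕ → ℝ, Tendsto u atTop (nhds (Real.exp (maxRate a r))) ∧
      ∀ᶠ n : ℕ in atTop, |SS a r n 1| ^ (1 / (n : ℝ)) ≤ u n := by
  set Z : ℝ := ∑' q : ℕ, 1 / (q : ℝ) ^ 2 with hZ
  have hsum : Summable fun q : ℕ => 1 / (q : ℝ) ^ 2 :=
    Real.summable_one_div_nat_pow.2 (by norm_num)
  have hZ0 : 0 < Z := hsum.tsum_pos (fun q => by positivity) 1 (by norm_num)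
  set C : ℝ := 30 ^ (2 * a + 5) * 3 ^ (r * (2 * a + 7)) *
    Real.exp (-(2 * a + 7 : ℕ) * maxRate a r) * Z with hC
  have hC0 : 0 < C := by positivity
  refine ⟨fun n => (C * (n : ℝ) ^ (2 * a + 7)) ^ (1 / (n : ℝ)) * Real.exp (maxRate a r), ?_, ?_⟩
  · simpa using (tendsto_const_mul_pow_rpow_inv hC0 (2 * a + 7)).mul_const (Real.exp (maxRate a r))
  · filter_upwards [eventually_ge_atTop (2 * a + 7)] with n hn
    have hS0 : 0 ≤ SS a r n 1 := by
      rw [SS_one]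
      exact tsum_nonneg (RR_nonneg a r n)
    rw [abs_of_nonneg hS0]
    have hS : SS a r n 1 ≤ (C * (n : ℝ) ^ (2 * a + 7)) * Real.exp (n * maxRate a r) := by
      rw [SS_one]
      refine ((summable_RR hr hra hn).tsum_le_tsum (RR_le_div_sq hr hra hn)
        (hsum.mul_left _)).trans (le_of_eq ?_)
      rw [tsum_mul_left, ← hZ, hC, sub_mul, sub_eq_add_neg, Real.exp_add, neg_mul]
      ring
    calc SS a r n 1 ^ (1 / (n : ℝ)) ≤
        ((C * (n : ℝ) ^ (2 * a + 7)) * Real.exp (n * maxRate a r)) ^ (1 / (n : ℝ)) :=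
          Real.rpow_le_rpow hS0 hS (by positivity)
      _ = _ := by
        rw [Real.mul_rpow (by positivity) (by positivity), exp_mul_rpow_one_div (by omega)]

lemma exists_le_SS_rpow {a r : ℕ} (hr : 1 ≤ r) (hra : 2 * r + 2 ≤ a) {x : ℝ} (hx : (r : ℝ) ≤ x) :
    ∃ u : ℕ → ℝ, Tendsto u atTop (nhds (Real.exp (rate a r x))) ∧
      ∀ᶠ n : ℕ in atTop, u n ≤ |SS a r n 1| ^ (1 / (n : ℝ)) := by
  set C : ℝ := (15 * (x + 2)) ^ (2 * a + 5) with hC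
  have hx0 : 0 ≤ x := (Nat.cast_nonneg r).trans hx
  have hC0 : 0 < C := by positivity
  refine ⟨fun n => ((C * (n : ℝ) ^ (2 * a + 5)) ^ (1 / (n : ℝ)))⁻¹ *
    Real.exp (rate a r (⌈x * n⌉₊ / n)), ?_, ?_⟩
  · have h1 : Tendsto (fun n : ℕ => (⌈x * n⌉₊ / n : ℝ)) atTop (nhds x) :=
      (tendsto_nat_ceil_mul_div_atTop hx0).comp tendsto_natCast_atTop_atTop
    have h2 := (Real.continuous_exp.comp (continuous_rate a r)).tendsto x |>.comp h1
    simpa using ((tendsto_const_mul_pow_rpow_inv hC0 (2 * a + 5)).inv₀ one_ne_zero).mul h2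
  · filter_upwards [eventually_ge_atTop (2 * a + 7)] with n hn
    have hn0 : 1 ≤ n := by omega
    have hn' : (1 : ℝ) ≤ n := by exact_mod_cast hn0
    have hS0 : 0 ≤ SS a r n 1 := by
      rw [SS_one]
      exact tsum_nonneg (RR_nonneg a r n)
    rw [abs_of_nonneg hS0]
    set q := ⌈x * n⌉₊ with hqdef
    have hq : r * n ≤ q := by
      have : (r * n : ℝ) ≤ q := (mul_le_mul_of_nonneg_right hx (by linarith)).trans (Nat.le_ceil _)
      exact_mod_cast this
    have h1 : RR a r n (q + 1) ≤ SS a r n 1 := by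
      rw [SS_one]
      exact (summable_RR hr hra hn).le_tsum q fun j _ => RR_nonneg a r n j
    have hq2 : (15 * (q + 1 : ℝ)) ^ (2 * a + 5) ≤ C * (n : ℝ) ^ (2 * a + 5) := by
      rw [hC, ← mul_pow]
      refine pow_le_pow_left₀ (by positivity) ?_ _
      have := Nat.ceil_lt_add_one (a := x * n) (by positivity)
      rw [← hqdef] at this
      nlinarith
    have h2 : Real.exp (n * rate a r (q / n)) ≤ (C * (n : ℝ) ^ (2 * a + 5)) * SS a r n 1 :=
      (RR_bounds hr (by omega) hn0 hq).1.trans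
        (mul_le_mul hq2 h1 (RR_nonneg a r n q) (by positivity))
    rw [inv_mul_le_iff₀ (by positivity), ← Real.mul_rpow (by positivity) hS0,
      ← exp_mul_rpow_one_div (n := n) (by omega)]
    exact Real.rpow_le_rpow (by positivity) h2 (by positivity)

theorem tendsto_SS_rpow {a r : ℕ} (hr : 1 ≤ r) (hra : 2 * r + 2 ≤ a) :
    Tendsto (fun n : ℕ => |SS a r n 1| ^ (1 / (n : ℝ))) atTop
      (nhds (Real.exp (maxRate a r))) := by
  rw [tendsto_order]
  constructor
  · intro c hc
    obtain ⟨x, hx, hcx⟩ : ∃ x : ℝ, (r : ℝ) ≤ x ∧ c < Real.exp (rate a r x) := by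
      rcases le_or_gt c 0 with hc0 | hc0
      · exact ⟨r, le_rfl, hc0.trans_lt (Real.exp_pos _)⟩
      · have h := (Real.log_lt_iff_lt_exp hc0).2 hc
        obtain ⟨_, ⟨x, hx, rfl⟩, hlt⟩ := exists_lt_of_lt_csSup
          (Set.image_nonempty.2 ⟨(r : ℝ), Set.self_mem_Ici⟩) h
        exact ⟨x, hx, (Real.log_lt_iff_lt_exp hc0).1 hlt⟩
    obtain ⟨u, hu, hle⟩ := exists_le_SS_rpow hr hra hx
    filter_upwards [hle, hu.eventually_const_lt hcx] with n h1 h2 using h2.trans_le h1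
  · intro c hc
    obtain ⟨u, hu, hle⟩ := exists_SS_rpow_le hr hra
    filter_upwards [hle, hu.eventually_lt_const hc] with n h1 h2 using h1.trans_lt h2

/-- The power series `x + X`. -/
noncomputable def lin (x : ℚ) : PowerSeries ℚ := PowerSeries.C x + PowerSeries.X

/-- The inverse of `x + X`, for `x ≠ 0`. -/
noncomputable def linInv (x : ℚ) : PowerSeries ℚ := PowerSeries.mk fun m => (-1) ^ m / x ^ (m + 1)

lemma coeff_lin_mul (x : ℚ) (f : PowerSeries ℚ) (m : ℕ) :
    PowerSeries.coeff m (lin x * f) =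
      x * PowerSeries.coeff m f + if m = 0 then 0 else PowerSeries.coeff (m - 1) f := by
  rw [lin, add_mul, map_add, PowerSeries.coeff_C_mul]
  rcases m with _ | m
  · simp
  · simp [PowerSeries.coeff_succ_X_mul]

lemma lin_mul_linInv {x : ℚ} (hx : x ≠ 0) : lin x * linInv x = 1 := by
  ext m
  rw [coeff_lin_mul, PowerSeries.coeff_one]
  rcases m with _ | m
  · simp [linInv, hx]
  · simp [linInv]
    field_simp
    ring

/-- The Taylor series of `R_n(k) (k + j)^a` at `k = -j`. -/
noncomputable def poleSeries (a r n j : ℕ) : PowerSeries ℚ :=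
  PowerSeries.C ((n.factorial : ℚ) ^ (a - 2 * r)) *
    (PowerSeries.C ((n : ℚ) - 2 * j) + PowerSeries.C 2 * PowerSeries.X) *
    (∏ i ∈ Finset.range (r * n), lin ((i : ℚ) - r * n - j)) *
    (∏ i ∈ Finset.range (r * n), lin ((n : ℚ) + 1 + i - j)) *
    (∏ l ∈ (Finset.range (n + 1)).erase j, linInv ((l : ℚ) - j)) ^ a

/-- The numerator of `R_n`. -/
noncomputable def numPoly (a r n : ℕ) : Polynomial ℚ :=
  Polynomial.C ((n.factorial : ℚ) ^ (a - 2 * r)) *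
    (Polynomial.C (n : ℚ) + Polynomial.C 2 * Polynomial.X) *
    (∏ i ∈ Finset.range (r * n), (Polynomial.X + Polynomial.C ((i : ℚ) - r * n))) *
    (∏ i ∈ Finset.range (r * n), (Polynomial.X + Polynomial.C ((n : ℚ) + 1 + i)))

/-- The denominator of `R_n` divided by `(k + j)^(a - m)`. -/
noncomputable def cofactorPoly (a n j m : ℕ) : Polynomial ℚ :=
  (∏ l ∈ (Finset.range (n + 1)).erase j, (Polynomial.X + Polynomial.C (l : ℚ))) ^ a *
    (Polynomial.X + Polynomial.C (j : ℚ)) ^ m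

/-- Expansion of a polynomial in powers of `X + j`, as a power series. -/
noncomputable def shift (j : ℚ) : Polynomial ℚ →ₐ[ℚ] PowerSeries ℚ :=
  Polynomial.aeval (PowerSeries.X - PowerSeries.C j)

lemma shift_X_add_C (j x : ℚ) : shift j (Polynomial.X + Polynomial.C x) = lin (x - j) := by
  rw [shift, map_add, Polynomial.aeval_X, Polynomial.aeval_C, lin, map_sub,
    PowerSeries.algebraMap_apply]
  simp
  ring

lemma shift_C (j x : ℚ) : shift j (Polynomial.C x) = PowerSeries.C x := by
  rw [shift, Polynomial.aeval_C, PowerSeries.algebraMap_apply]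
  simp

lemma pow_dvd_of_shift {j : ℚ} {m : ℕ} {p : Polynomial ℚ}
    (h : PowerSeries.X ^ m ∣ shift j p) : (Polynomial.X + Polynomial.C j) ^ m ∣ p := by
  have h1 : shift j p = ((p.comp (Polynomial.X - Polynomial.C j) : Polynomial ℚ) :
      PowerSeries ℚ) := by
    rw [shift, Polynomial.comp, ← Polynomial.coeToPowerSeries.ringHom_apply,
      Polynomial.hom_eval₂, Polynomial.aeval_def]
    congr 1
    · ext x
      simp
    · simp
  have h2 : (Polynomial.X : Polynomial ℚ) ^ m ∣ p.comp (Polynomial.X - Polynomial.C j) := by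
    rw [Polynomial.X_pow_dvd_iff]
    intro d hd
    rw [← Polynomial.coeff_coe, ← h1]
    exact PowerSeries.X_pow_dvd_iff.1 h d hd
  obtain ⟨q, hq⟩ := h2
  refine ⟨q.comp (Polynomial.X + Polynomial.C j), ?_⟩
  have h3 := congrArg (fun s => s.comp (Polynomial.X + Polynomial.C j)) hq
  simpa [Polynomial.comp_assoc] using h3

lemma prod_lin_mul_prod_linInv (n j : ℕ) :
    (∏ l ∈ (Finset.range (n + 1)).erase j, lin ((l : ℚ) - j)) *
      (∏ l ∈ (Finset.range (n + 1)).erase j, linInv ((l : ℚ) - j)) = 1 := by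
  rw [← Finset.prod_mul_distrib]
  refine Finset.prod_eq_one fun l hl => lin_mul_linInv ?_
  rw [sub_ne_zero]
  exact_mod_cast (Finset.mem_erase.1 hl).1

lemma shift_numPoly (a r n j : ℕ) :
    shift j (numPoly a r n) = poleSeries a r n j *
      (∏ l ∈ (Finset.range (n + 1)).erase j, lin ((l : ℚ) - j)) ^ a := by
  have h1 : ∀ i : ℕ, shift j (Polynomial.X + Polynomial.C ((i : ℚ) - r * n)) =
      lin ((i : ℚ) - r * n - j) := fun i => shift_X_add_C _ _
  have h2 : ∀ i : ℕ, shift j (Polynomial.X + Polynomial.C ((n : ℚ) + 1 + i)) =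
      lin ((n : ℚ) + 1 + i - j) := fun i => shift_X_add_C _ _
  have h3 : shift j (Polynomial.C (n : ℚ) + Polynomial.C 2 * Polynomial.X) =
      PowerSeries.C ((n : ℚ) - 2 * j) + PowerSeries.C 2 * PowerSeries.X := by
    have : (Polynomial.C (n : ℚ) + Polynomial.C 2 * Polynomial.X) =
      Polynomial.C 2 * (Polynomial.X + Polynomial.C ((n : ℚ) / 2)) := by
      rw [mul_add, ← Polynomial.C_mul, mul_div_cancel₀ _ (by norm_num : (2 : ℚ) ≠ 0), add_comm]
    rw [this, map_mul, shift_X_add_C, shift_C, lin, mul_add, ← map_mul]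
    congr 2
    ring
  rw [numPoly, poleSeries, map_mul, map_mul, map_mul, shift_C, h3, map_prod, map_prod]
  simp only [h1, h2]
  rw [mul_assoc _ (_ ^ a) (_ ^ a), ← mul_pow, mul_comm (∏ l ∈ _, linInv _),
    prod_lin_mul_prod_linInv, one_pow, mul_one]

lemma shift_cofactorPoly_self (a n j m : ℕ) :
    shift j (cofactorPoly a n j m) =
      (∏ l ∈ (Finset.range (n + 1)).erase j, lin ((l : ℚ) - j)) ^ a * PowerSeries.X ^ m := by
  rw [cofactorPoly, map_mul, map_pow, map_pow, map_prod, shift_X_add_C]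
  simp only [shift_X_add_C]
  simp [lin]

lemma X_pow_dvd_shift_cofactorPoly {a n j i m : ℕ} (hj : j ∈ Finset.range (n + 1)) (hij : j ≠ i) :
    PowerSeries.X ^ a ∣ shift j (cofactorPoly a n i m) := by
  rw [cofactorPoly, map_mul, map_pow, map_prod]
  refine Dvd.dvd.mul_right (pow_dvd_pow_of_dvd ?_ a) _
  refine Dvd.dvd.trans ?_ (Finset.dvd_prod_of_mem _ (Finset.mem_erase.2 ⟨hij, hj⟩))
  rw [shift_X_add_C]
  simp [lin]

lemma monic_cofactorPoly (a n j m : ℕ) : (cofactorPoly a n j m).Monic :=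
  ((Polynomial.monic_prod_of_monic _ _ fun _ _ => Polynomial.monic_X_add_C _).pow a).mul
    ((Polynomial.monic_X_add_C _).pow m)

lemma natDegree_cofactorPoly {a n j m : ℕ} (hj : j ∈ Finset.range (n + 1)) :
    (cofactorPoly a n j m).natDegree = a * n + m := by
  have h : ∀ l ∈ (Finset.range (n + 1)).erase j,
      (Polynomial.X + Polynomial.C (l : ℚ)).Monic := fun _ _ => Polynomial.monic_X_add_C _
  rw [cofactorPoly, ((Polynomial.monic_prod_of_monic _ _ h).pow a).natDegree_mul
    ((Polynomial.monic_X_add_C _).pow m), (Polynomial.monic_prod_of_monic _ _ h).natDegree_pow,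
    (Polynomial.monic_X_add_C _).natDegree_pow, Polynomial.natDegree_prod_of_monic _ _ h]
  simp only [Polynomial.natDegree_X_add_C, Finset.sum_const, Finset.card_erase_of_mem hj,
    Finset.card_range, smul_eq_mul, mul_one, Nat.add_sub_cancel]

lemma natDegree_numPoly_le (a r n : ℕ) : (numPoly a r n).natDegree ≤ 2 * (r * n) + 1 := by
  have h : ∀ c : ℕ → ℚ, (∏ i ∈ Finset.range (r * n),
      (Polynomial.X + Polynomial.C (c i))).natDegree ≤ r * n := by
    intro c
    rw [Polynomial.natDegree_prod_of_monic _ _ fun _ _ => Polynomial.monic_X_add_C _]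
    simp
  have h0 : (Polynomial.C (n : ℚ) + Polynomial.C 2 * Polynomial.X).natDegree ≤ 1 := by
    rw [add_comm]
    exact Polynomial.natDegree_linear_le
  have h1 := Polynomial.natDegree_mul_le_of_le (Polynomial.natDegree_mul_le_of_le
    (Polynomial.natDegree_mul_le_of_le (Polynomial.natDegree_C
      ((n.factorial : ℚ) ^ (a - 2 * r))).le h0)
    (h fun i => (i : ℚ) - r * n)) (h fun i => (n : ℚ) + 1 + i)
  unfold numPoly
  refine h1.trans (by omega)

/-- The partial fraction expansion of `R_n`, with denominators cleared. -/
theorem numPoly_eq_sum {a r n : ℕ} (hra : 2 * r + 2 ≤ a) (hr : 1 ≤ r) :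
    numPoly a r n = ∑ j ∈ Finset.range (n + 1), ∑ m ∈ Finset.range a,
      Polynomial.C (PowerSeries.coeff m (poleSeries a r n j)) * cofactorPoly a n j m := by
  rw [← sub_eq_zero]
  set D := numPoly a r n - ∑ j ∈ Finset.range (n + 1), ∑ m ∈ Finset.range a,
      Polynomial.C (PowerSeries.coeff m (poleSeries a r n j)) * cofactorPoly a n j m with hD
  have hdeg : D.natDegree < a * (n + 1) := by
    have h0 : D.natDegree ≤ a * n + (a - 1) := by
      refine (Polynomial.natDegree_sub_le _ _).trans
        (max_le ((natDegree_numPoly_le a r n).trans ?_) ?_)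
      · have : 2 * r * n ≤ a * n := Nat.mul_le_mul_right n (by omega)
        rw [← mul_assoc]
        omega
      · refine Polynomial.natDegree_sum_le_of_forall_le _ _ fun j hj =>
          Polynomial.natDegree_sum_le_of_forall_le _ _ fun m hm => ?_
        refine (Polynomial.natDegree_C_mul_le _ _).trans ?_
        rw [natDegree_cofactorPoly hj]
        have := Finset.mem_range.1 hm
        omega
    rw [mul_add]
    omega
  have hdvd : ∀ j ∈ Finset.range (n + 1), (Polynomial.X + Polynomial.C (j : ℚ)) ^ a ∣ D := by
    intro j hj
    apply pow_dvd_of_shift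
    rw [hD, map_sub, map_sum, ← Finset.add_sum_erase _ _ hj, ← sub_sub]
    refine dvd_sub ?_ (Finset.dvd_sum fun i hi => ?_)
    · rw [shift_numPoly, map_sum]
      simp only [map_mul, shift_C, shift_cofactorPoly_self]
      set g := poleSeries a r n j
      set Q := (∏ l ∈ (Finset.range (n + 1)).erase j, lin ((l : ℚ) - j)) ^ a
      have : g * Q - ∑ m ∈ Finset.range a, PowerSeries.C (PowerSeries.coeff m g) *
          (Q * PowerSeries.X ^ m) = Q * (g - ∑ m ∈ Finset.range a,
            PowerSeries.C (PowerSeries.coeff m g) * PowerSeries.X ^ m) := by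
        rw [mul_sub, Finset.mul_sum, mul_comm g]
        congr 1
        exact Finset.sum_congr rfl fun m _ => by ring
      rw [this]
      refine Dvd.dvd.mul_left (PowerSeries.X_pow_dvd_iff.2 fun d hd => ?_) _
      rw [map_sub, map_sum]
      simp only [PowerSeries.coeff_C_mul, PowerSeries.coeff_X_pow]
      simp [hd]
    · rw [map_sum]
      refine Finset.dvd_sum fun m _ => ?_
      rw [map_mul]
      exact Dvd.dvd.mul_left (X_pow_dvd_shift_cofactorPoly hj (Finset.mem_erase.1 hi).1.symm) _
  have hprod : ∏ j ∈ Finset.range (n + 1), (Polynomial.X + Polynomial.C (j : ℚ)) ^ a ∣ D := by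
    refine Finset.prod_dvd_of_coprime ?_ hdvd
    intro i _ j _ hij
    refine IsCoprime.pow ?_
    have h := Polynomial.isCoprime_X_sub_C_of_isUnit_sub (a := -(i : ℚ)) (b := -(j : ℚ))
      (isUnit_iff_ne_zero.2 (by
        rw [sub_ne_zero, Ne, neg_inj]
        exact_mod_cast hij))
    simpa using h
  by_contra hne
  have := Polynomial.natDegree_le_of_dvd hprod hne
  rw [Finset.prod_pow, (Polynomial.monic_prod_of_monic _ _
    fun _ _ => Polynomial.monic_X_add_C _).natDegree_pow,
    Polynomial.natDegree_prod_of_monic _ _ fun _ _ => Polynomial.monic_X_add_C _] at this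
  simp only [Polynomial.natDegree_X_add_C, Finset.sum_const, Finset.card_range, smul_eq_mul,
    mul_one] at this
  omega

/-- The residues of `R_n` sum to zero. -/
theorem sum_coeff_pred {a r n : ℕ} (hra : 2 * r + 2 ≤ a) (hr : 1 ≤ r) :
    ∑ j ∈ Finset.range (n + 1), PowerSeries.coeff (a - 1) (poleSeries a r n j) = 0 := by
  have h := congrArg (fun p => Polynomial.coeff p (a * n + (a - 1))) (numPoly_eq_sum (n := n) hra hr)
  simp only [Polynomial.finsetSum_coeff, Polynomial.coeff_C_mul] at h
  have h0 : (numPoly a r n).coeff (a * n + (a - 1)) = 0 := by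
    refine Polynomial.coeff_eq_zero_of_natDegree_lt ((natDegree_numPoly_le a r n).trans_lt ?_)
    have : 2 * r * n ≤ a * n := Nat.mul_le_mul_right n (by omega)
    rw [← mul_assoc]
    omega
  rw [h0] at h
  rw [h]
  refine Finset.sum_congr rfl fun j hj => ?_
  rw [Finset.sum_eq_single (a - 1)]
  · have := (monic_cofactorPoly a n j (a - 1)).coeff_natDegree
    rw [natDegree_cofactorPoly hj] at this
    rw [this, mul_one]
  · intro m hm hne
    rw [Polynomial.coeff_eq_zero_of_natDegree_lt, mul_zero]
    rw [natDegree_cofactorPoly hj]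
    have := Finset.mem_range.1 hm
    omega
  · intro h
    simp at h
    omega

/-- The partial fraction expansion of `R_n`. -/
theorem RR_eq_sum {a r n : ℕ} (hra : 2 * r + 2 ≤ a) (hr : 1 ≤ r) (q : ℕ) :
    RR a r n (q + 1) = ∑ j ∈ Finset.range (n + 1), ∑ m ∈ Finset.range a,
      ((PowerSeries.coeff m (poleSeries a r n j) : ℚ) : ℝ) / ((q : ℝ) + 1 + j) ^ (a - m) := by
  have h := congrArg (fun p => ((Polynomial.eval ((q : ℚ) + 1) p : ℚ) : ℝ))
    (numPoly_eq_sum (n := n) hra hr)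
  have hpoch : poch ((q : ℝ) + 1) (n + 1) ≠ 0 :=
    (Finset.prod_pos fun i _ => by positivity).ne'
  have h1 : ((Polynomial.eval ((q : ℚ) + 1) (numPoly a r n) : ℚ) : ℝ) =
      RR a r n (q + 1) * (poch ((q : ℝ) + 1) (n + 1)) ^ a := by
    rw [RR, div_mul_cancel₀ _ (pow_ne_zero a hpoch), numPoly, poch, poch]
    simp only [Polynomial.eval_mul, Polynomial.eval_prod, Polynomial.eval_add, Polynomial.eval_C,
      Polynomial.eval_X]
    push_cast
    have e1 : ∀ i ∈ Finset.range (r * n), ((q : ℝ) + 1 + (i - r * n)) = q + 1 - r * n + i :=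
      fun i _ => by ring
    have e2 : ∀ i ∈ Finset.range (r * n), ((q : ℝ) + 1 + (n + 1 + i)) = q + 1 + n + 1 + i :=
      fun i _ => by ring
    rw [Finset.prod_congr rfl e1, Finset.prod_congr rfl e2]
    ring
  have h2 : ∀ j ∈ Finset.range (n + 1), ∀ m ∈ Finset.range a,
      ((Polynomial.eval ((q : ℚ) + 1) (cofactorPoly a n j m) : ℚ) : ℝ) =
        (poch ((q : ℝ) + 1) (n + 1)) ^ a / ((q : ℝ) + 1 + j) ^ (a - m) := by
    intro j hj m hm
    rw [eq_div_iff (by positivity), cofactorPoly, poch, ← Finset.mul_prod_erase _ _ hj, mul_pow]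
    simp only [Polynomial.eval_mul, Polynomial.eval_prod, Polynomial.eval_add, Polynomial.eval_C,
      Polynomial.eval_X, Polynomial.eval_pow]
    push_cast
    rw [mul_assoc, ← pow_add, Nat.add_sub_cancel' (Finset.mem_range.1 hm).le, mul_comm]
  rw [h1] at h
  rw [← mul_left_inj' (pow_ne_zero a hpoch), h]
  simp only [Polynomial.eval_finsetSum, Polynomial.eval_mul, Polynomial.eval_C]
  push_cast
  rw [Finset.sum_mul]
  refine Finset.sum_congr rfl fun j hj => ?_
  rw [Finset.sum_mul]
  refine Finset.sum_congr rfl fun m hm => ?_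
  rw [h2 j hj m hm]
  ring

/-- The coefficients of `f` are dominated by those of `A / (1 - M X)`. -/
def CoeffBound (A : ℚ) (M : ℕ) (f : PowerSeries ℚ) : Prop :=
  ∀ m, |PowerSeries.coeff m f| ≤ A * (M : ℚ) ^ m

lemma CoeffBound.nonneg {A : ℚ} {M : ℕ} {f : PowerSeries ℚ} (h : CoeffBound A M f) : 0 ≤ A := by
  simpa using (abs_nonneg _).trans (h 0)

lemma sum_antidiagonal_pow_mul_pow_le (M N m : ℕ) :
    ∑ p ∈ Finset.HasAntidiagonal.antidiagonal m, (M : ℚ) ^ p.1 * (N : ℚ) ^ p.2 ≤ ((M + N : ℕ) : ℚ) ^ m := by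
  push_cast
  rw [Commute.add_pow' (Commute.all _ _)]
  refine Finset.sum_le_sum fun p hp => ?_
  rw [nsmul_eq_mul]
  refine le_mul_of_one_le_left (by positivity) ?_
  have h := Nat.choose_pos (show p.1 ≤ m by
    have := Finset.HasAntidiagonal.mem_antidiagonal.1 hp
    omega)
  exact_mod_cast h

lemma CoeffBound.mul {A B : ℚ} {M N : ℕ} {f g : PowerSeries ℚ} (hf : CoeffBound A M f)
    (hg : CoeffBound B N g) : CoeffBound (A * B) (M + N) (f * g) := by
  intro m
  rw [PowerSeries.coeff_mul]
  calc |∑ p ∈ Finset.HasAntidiagonal.antidiagonal m, PowerSeries.coeff p.1 f * PowerSeries.coeff p.2 g|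
      ≤ ∑ p ∈ Finset.HasAntidiagonal.antidiagonal m, |PowerSeries.coeff p.1 f * PowerSeries.coeff p.2 g| :=
        Finset.abs_sum_le_sum_abs _ _
    _ ≤ ∑ p ∈ Finset.HasAntidiagonal.antidiagonal m, A * B * ((M : ℚ) ^ p.1 * (N : ℚ) ^ p.2) := by
        refine Finset.sum_le_sum fun p _ => ?_
        rw [abs_mul]
        calc _ ≤ (A * (M : ℚ) ^ p.1) * (B * (N : ℚ) ^ p.2) :=
              mul_le_mul (hf _) (hg _) (abs_nonneg _) ((abs_nonneg _).trans (hf _))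
          _ = _ := by ring
    _ ≤ _ := by
        rw [← Finset.mul_sum]
        exact mul_le_mul_of_nonneg_left (sum_antidiagonal_pow_mul_pow_le M N m)
          (mul_nonneg hf.nonneg hg.nonneg)

lemma CoeffBound.prod {ι : Type*} (s : Finset ι) {A : ι → ℚ} {f : ι → PowerSeries ℚ}
    (h : ∀ i ∈ s, CoeffBound (A i) 1 (f i)) : CoeffBound (∏ i ∈ s, A i) s.card (∏ i ∈ s, f i) := by
  classical
  induction s using Finset.induction_on with
  | empty =>
    intro m
    rcases m with _ | m <;> simp [PowerSeries.coeff_one]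
  | insert i s hi ih =>
    rw [Finset.prod_insert hi, Finset.prod_insert hi, Finset.card_insert_of_notMem hi, add_comm]
    exact (h i (Finset.mem_insert_self i s)).mul
      (ih fun j hj => h j (Finset.mem_insert_of_mem hj))

lemma CoeffBound.pow {A : ℚ} {M : ℕ} {f : PowerSeries ℚ} (h : CoeffBound A M f) (a : ℕ) :
    CoeffBound (A ^ a) (a * M) (f ^ a) := by
  induction a with
  | zero =>
    intro m
    rcases m with _ | m <;> simp [PowerSeries.coeff_one]
  | succ a ih =>
    rw [pow_succ, pow_succ, add_mul, one_mul]
    exact ih.mul h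

lemma coeffBound_lin {x : ℚ} (hx : 1 ≤ |x|) : CoeffBound |x| 1 (lin x) := by
  intro m
  have := coeff_lin_mul x 1 m
  rw [mul_one] at this
  rw [this, PowerSeries.coeff_one]
  rcases m with _ | _ | m <;> simp [PowerSeries.coeff_one, hx]

lemma coeffBound_linInv {x : ℚ} (hx : 1 ≤ |x|) : CoeffBound |x|⁻¹ 1 (linInv x) := by
  intro m
  rw [linInv, PowerSeries.coeff_mk, abs_div, abs_pow, abs_pow, abs_neg, abs_one, one_pow,
    Nat.cast_one, one_pow, mul_one, one_div]
  exact inv_anti₀ (by linarith) (le_self_pow₀ hx (by omega))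

lemma coeffBound_C (x : ℚ) : CoeffBound |x| 0 (PowerSeries.C x) := by
  intro m
  rcases m with _ | m <;> simp [PowerSeries.coeff_C]

lemma coeffBound_linear {n j : ℕ} (hj : j ≤ n) :
    CoeffBound (n + 2) 1 (PowerSeries.C ((n : ℚ) - 2 * j) + PowerSeries.C 2 * PowerSeries.X) := by
  have hj' : (j : ℚ) ≤ n := by exact_mod_cast hj
  have hj0 : (0 : ℚ) ≤ j := by positivity
  intro m
  rw [map_add, PowerSeries.coeff_C_mul, PowerSeries.coeff_C, PowerSeries.coeff_X]
  rcases m with _ | _ | m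
  · simp [abs_le]
    constructor <;> linarith
  · simp
  · simp
    positivity

lemma prod_erase_sub {n j : ℕ} (hj : j ≤ n) :
    ∏ l ∈ (Finset.range (n + 1)).erase j, ((l : ℚ) - j) =
      (-1) ^ j * (j.factorial * (n - j).factorial) := by
  obtain ⟨t, rfl⟩ := Nat.exists_eq_add_of_le hj
  have h1 : ∏ l ∈ (Finset.range (j + t + 1)).erase j, ((l : ℚ) - j) =
      ∏ l ∈ (Finset.range (j + t + 1)).erase j, if l = j then 1 else ((l : ℚ) - j) :=
    Finset.prod_congr rfl fun l hl => by rw [if_neg (Finset.mem_erase.1 hl).1]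
  have h2 : ∏ l ∈ Finset.range j, (if l = j then 1 else ((l : ℚ) - j)) =
      (-1) ^ j * j.factorial := by
    rw [← Finset.prod_range_add_one_eq_factorial, ← Finset.prod_range_reflect]
    push_cast
    rw [← Finset.card_range j, ← Finset.prod_const, Finset.card_range, ← Finset.prod_mul_distrib]
    refine Finset.prod_congr rfl fun l hl => ?_
    have hl := Finset.mem_range.1 hl
    rw [if_neg (by omega), Nat.cast_sub (by omega), Nat.cast_sub (by omega)]
    push_cast
    ring
  rw [h1, Finset.prod_erase _ (by simp), add_assoc, Finset.prod_range_add, h2,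
    Finset.prod_range_succ', Nat.add_sub_cancel_left, ← Finset.prod_range_add_one_eq_factorial t]
  have h3 : ∏ x ∈ Finset.range t, (if j + (x + 1) = j then 1 else (((j + (x + 1) : ℕ) : ℚ) - j)) =
      ∏ x ∈ Finset.range t, ((x + 1 : ℕ) : ℚ) :=
    Finset.prod_congr rfl fun x _ => by
      rw [if_neg (by omega)]
      push_cast
      ring
  rw [h3, add_zero, if_pos rfl, mul_one, Nat.cast_prod, mul_assoc]

lemma prod_abs_inv {n j : ℕ} (hj : j ≤ n) :
    ∏ l ∈ (Finset.range (n + 1)).erase j, |(l : ℚ) - j|⁻¹ =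
      ((j.factorial : ℚ) * (n - j).factorial)⁻¹ := by
  rw [Finset.prod_inv_distrib, ← Finset.abs_prod, prod_erase_sub hj, abs_mul, abs_pow, abs_neg,
    abs_one, one_pow, one_mul, abs_of_nonneg (by positivity)]

lemma prod_add_one_add (j t : ℕ) :
    ∏ i ∈ Finset.range t, ((j : ℚ) + 1 + i) = ((j + t).factorial : ℚ) / j.factorial := by
  rw [eq_div_iff (by positivity)]
  induction t with
  | zero => simp
  | succ t ih =>
    rw [Finset.prod_range_succ, mul_right_comm, ih, ← add_assoc, Nat.factorial_succ]
    push_cast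
    ring

lemma prod_abs_sub_sub (r n j : ℕ) :
    ∏ i ∈ Finset.range (r * n), |(i : ℚ) - r * n - j| =
      ((j + r * n).factorial : ℚ) / j.factorial := by
  rw [← prod_add_one_add, ← Finset.prod_range_reflect]
  refine Finset.prod_congr rfl fun i hi => ?_
  have hi := Finset.mem_range.1 hi
  rw [Nat.cast_sub (by omega), Nat.cast_sub (by omega)]
  push_cast
  rw [← abs_neg, abs_of_nonneg]
  · ring
  · have : (0 : ℚ) ≤ j := by positivity
    have : (0 : ℚ) ≤ i := by positivity
    linarith

lemma prod_abs_add_sub {r n j : ℕ} (hj : j ≤ n) :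
    ∏ i ∈ Finset.range (r * n), |(n : ℚ) + 1 + i - j| =
      ((n - j + r * n).factorial : ℚ) / (n - j).factorial := by
  rw [← prod_add_one_add]
  refine Finset.prod_congr rfl fun i hi => ?_
  have : (j : ℚ) ≤ n := by exact_mod_cast hj
  have : (0 : ℚ) ≤ i := by positivity
  rw [Nat.cast_sub hj, abs_of_nonneg (by linarith)]
  ring

/-- A multinomial coefficient with `k` parts of sum `N` is at most `k ^ N`. -/
lemma factorial_sum_le (L : List ℕ) :
    L.sum.factorial ≤ L.length ^ L.sum * (L.map Nat.factorial).prod := by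
  induction L with
  | nil => simp
  | cons s L ih =>
    simp only [List.sum_cons, List.length_cons, List.map_cons, List.prod_cons]
    have h1 : L.length ^ L.sum * (s + L.sum).choose s ≤ (L.length + 1) ^ (s + L.sum) := by
      rw [add_comm L.length 1, add_pow]
      refine le_trans (le_of_eq ?_) (Finset.single_le_sum
        (f := fun m => 1 ^ m * L.length ^ (s + L.sum - m) * (s + L.sum).choose m)
        (fun _ _ => Nat.zero_le _) (Finset.mem_range.2 (by omega : s < s + L.sum + 1)))
      simp
    have h2 := Nat.add_choose_mul_factorial_mul_factorial s L.sum
    rw [← Nat.choose_symm_add] at h2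
    calc (s + L.sum).factorial = (s + L.sum).choose s * s.factorial * L.sum.factorial := h2.symm
      _ ≤ (s + L.sum).choose s * s.factorial *
          (L.length ^ L.sum * (L.map Nat.factorial).prod) := Nat.mul_le_mul_left _ ih
      _ = L.length ^ L.sum * (s + L.sum).choose s * (s.factorial *
          (L.map Nat.factorial).prod) := by ring
      _ ≤ _ := Nat.mul_le_mul_right _ h1

lemma factorial_add_mul_le (r j t : ℕ) :
    (j + r * (j + t)).factorial ≤ (2 * r + 1) ^ (j + r * (j + t)) *
      (j.factorial ^ (r + 1) * t.factorial ^ r) := by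
  have h := factorial_sum_le (List.replicate (r + 1) j ++ List.replicate r t)
  have e : (List.replicate (r + 1) j ++ List.replicate r t).sum = j + r * (j + t) := by
    simp
    ring
  rw [e] at h
  simpa [show r + 1 + r = 2 * r + 1 by ring] using h

lemma coeff_size_le {a r n j : ℕ} (hra : 2 * r ≤ a) (hj : j ≤ n) :
    (n.factorial : ℚ) ^ (a - 2 * r) * (((j + r * n).factorial : ℚ) / j.factorial) *
      (((n - j + r * n).factorial : ℚ) / (n - j).factorial) *
      (((j.factorial : ℚ) * (n - j).factorial)⁻¹) ^ a ≤
    (2 ^ (a - 2 * r) * (2 * r + 1 : ℚ) ^ (2 * r + 1)) ^ n := by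
  obtain ⟨t, rfl⟩ := Nat.exists_eq_add_of_le hj
  obtain ⟨b, rfl⟩ := Nat.exists_eq_add_of_le hra
  rw [Nat.add_sub_cancel_left, Nat.add_sub_cancel_left]
  have h1 : ((j + t).factorial : ℚ) ≤ 2 ^ (j + t) * (j.factorial * t.factorial) := by
    have h := factorial_sum_le [j, t]
    simp at h
    exact_mod_cast h
  have h2 : ((j + r * (j + t)).factorial : ℚ) ≤ (2 * r + 1) ^ (j + r * (j + t)) *
      (j.factorial ^ (r + 1) * t.factorial ^ r) := by
    exact_mod_cast factorial_add_mul_le r j t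
  have h3 : ((t + r * (j + t)).factorial : ℚ) ≤ (2 * r + 1) ^ (t + r * (j + t)) *
      (t.factorial ^ (r + 1) * j.factorial ^ r) := by
    have h := factorial_add_mul_le r t j
    rw [add_comm t j] at h
    exact_mod_cast h
  calc _ ≤ (2 ^ (j + t) * (j.factorial * t.factorial) : ℚ) ^ b *
        (((2 * r + 1) ^ (j + r * (j + t)) * (j.factorial ^ (r + 1) * t.factorial ^ r)) /
          j.factorial) *
        (((2 * r + 1) ^ (t + r * (j + t)) * (t.factorial ^ (r + 1) * j.factorial ^ r)) /
          t.factorial) * (((j.factorial : ℚ) * t.factorial)⁻¹) ^ (2 * r + b) := by gcongr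
    _ = (2 ^ (j + t)) ^ b * ((2 * r + 1) ^ (j + r * (j + t)) * (2 * r + 1) ^ (t + r * (j + t))) := by
      rw [inv_pow, pow_add _ (2 * r), mul_pow _ _ (2 * r), mul_pow _ (_ * _) b, mul_pow _ _ b]
      field_simp
      ring
    _ = _ := by
      rw [← pow_add, mul_pow, ← pow_mul, ← pow_mul, ← pow_mul, mul_comm b]
      congr 2
      ring

/-- The coefficients of the partial fraction expansion grow at most like
`(2^(a-2r) (2r+1)^(2r+1))^n`, up to a polynomial factor. -/
theorem abs_coeff_poleSeries_le {a r n j : ℕ} (hra : 2 * r ≤ a) (hj : j ≤ n) (m : ℕ) :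
    |PowerSeries.coeff m (poleSeries a r n j)| ≤
      (n + 2) * (2 ^ (a - 2 * r) * (2 * r + 1 : ℚ) ^ (2 * r + 1)) ^ n *
        (1 + (2 * r + a) * n) ^ m := by
  have hj' : (j : ℚ) ≤ n := by exact_mod_cast hj
  have hj0 : (0 : ℚ) ≤ j := by positivity
  have b1 : CoeffBound (∏ i ∈ Finset.range (r * n), |(i : ℚ) - r * n - j|) (r * n)
      (∏ i ∈ Finset.range (r * n), lin ((i : ℚ) - r * n - j)) := by
    have := CoeffBound.prod (Finset.range (r * n)) (fun i hi => coeffBound_lin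
      (x := (i : ℚ) - r * n - j) (by
        have : (i : ℚ) + 1 ≤ r * n := by exact_mod_cast Finset.mem_range.1 hi
        rw [le_abs]
        right
        linarith))
    rwa [Finset.card_range] at this
  have b2 : CoeffBound (∏ i ∈ Finset.range (r * n), |(n : ℚ) + 1 + i - j|) (r * n)
      (∏ i ∈ Finset.range (r * n), lin ((n : ℚ) + 1 + i - j)) := by
    have := CoeffBound.prod (Finset.range (r * n)) (fun i hi => coeffBound_lin
      (x := (n : ℚ) + 1 + i - j) (by
        have : (0 : ℚ) ≤ i := by positivity
        rw [le_abs]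
        left
        linarith))
    rwa [Finset.card_range] at this
  have b3 : CoeffBound (∏ l ∈ (Finset.range (n + 1)).erase j, |(l : ℚ) - j|⁻¹) n
      (∏ l ∈ (Finset.range (n + 1)).erase j, linInv ((l : ℚ) - j)) := by
    have := CoeffBound.prod ((Finset.range (n + 1)).erase j) (fun l hl => coeffBound_linInv
      (x := (l : ℚ) - j) (by
        have : (l : ℤ) - j ≠ 0 := by
          have := (Finset.mem_erase.1 hl).1
          omega
        exact_mod_cast Int.one_le_abs this))
    rwa [Finset.card_erase_of_mem (Finset.mem_range.2 (by omega)), Finset.card_range,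
      Nat.add_sub_cancel] at this
  have h := ((((coeffBound_C ((n.factorial : ℚ) ^ (a - 2 * r))).mul (coeffBound_linear hj)).mul
    b1).mul b2).mul (b3.pow a) m
  rw [prod_abs_sub_sub, prod_abs_add_sub hj, prod_abs_inv hj,
    abs_of_nonneg (show (0 : ℚ) ≤ (n.factorial : ℚ) ^ (a - 2 * r) by positivity)] at h
  refine h.trans ?_
  have hs := coeff_size_le hra hj
  refine mul_le_mul ?_ (le_of_eq ?_) (by positivity) (by positivity)
  · calc _ = ((n : ℚ) + 2) * _ := by ring
      _ ≤ _ := mul_le_mul_of_nonneg_left hs (by positivity)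
  · congr 1
    push_cast
    ring

/-- The power series `f` such that `d ^ m` times the `m`-th coefficient is always an integer. -/
noncomputable def denomSubring (d : ℕ) : Subring (PowerSeries ℚ) :=
  (PowerSeries.map (Int.castRingHom ℚ)).range.comap (PowerSeries.rescale (d : ℚ))

lemma mem_denomSubring {d : ℕ} {f : PowerSeries ℚ} :
    f ∈ denomSubring d ↔ ∀ m, ∃ z : ℤ, (d : ℚ) ^ m * PowerSeries.coeff m f = z := by
  rw [denomSubring, Subring.mem_comap, RingHom.mem_range]
  constructor
  · rintro ⟨g, hg⟩ m
    refine ⟨PowerSeries.coeff m g, ?_⟩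
    rw [← PowerSeries.coeff_rescale, ← hg]
    simp
  · intro h
    choose z hz using h
    refine ⟨PowerSeries.mk z, ?_⟩
    ext m
    rw [PowerSeries.coeff_rescale, hz]
    simp

lemma C_int_mem_denomSubring (d : ℕ) (z : ℤ) : PowerSeries.C (z : ℚ) ∈ denomSubring d := by
  rw [show PowerSeries.C (z : ℚ) = ((z : ℤ) : PowerSeries ℚ) by simp]
  exact intCast_mem _ z

lemma X_mem_denomSubring (d : ℕ) : PowerSeries.X ∈ denomSubring d := by
  rw [mem_denomSubring]
  intro m
  rw [PowerSeries.coeff_X]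
  split_ifs with h
  · exact ⟨d, by simp [h]⟩
  · exact ⟨0, by simp⟩

lemma X_mul_linInv_mem_denomSubring {d : ℕ} {x : ℤ} (hx : x ∣ d) :
    PowerSeries.X * linInv x ∈ denomSubring d := by
  rw [mem_denomSubring]
  rintro (_ | m)
  · exact ⟨0, by simp⟩
  · obtain ⟨y, hy⟩ := hx
    rw [PowerSeries.coeff_succ_X_mul, linInv, PowerSeries.coeff_mk]
    have hd : (d : ℚ) = x * y := by exact_mod_cast hy
    rcases eq_or_ne x 0 with rfl | h0
    · exact ⟨0, by simp⟩
    · have h0' : (x : ℚ) ≠ 0 := by exact_mod_cast h0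
      refine ⟨(-1) ^ m * y ^ (m + 1), ?_⟩
      rw [hd]
      push_cast
      field_simp
      ring

lemma sub_dvd_dlcm {n j l : ℕ} (hj : j ≤ n) (hl : l ≤ n) (hjl : l ≠ j) :
    (l : ℤ) - j ∣ dlcm n := by
  rw [← Int.natAbs_dvd, Int.natCast_dvd_natCast]
  have h1 : 1 ≤ ((l : ℤ) - j).natAbs := by omega
  have h2 : ((l : ℤ) - j).natAbs ≤ n := by omega
  exact Finset.dvd_lcm (f := id) (Finset.mem_Icc.2 ⟨h1, h2⟩)

/-- If the polynomial `p` of degree at most `n` takes values divisible by `n!` at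
`0, -1, …, -n`, then the Taylor coefficients of `p(k) (k + j) / (k)_{n+1}` at `k = -j`
have denominators controlled by powers of `d_n`. -/
lemma shift_mul_prod_linInv_mem {n j : ℕ} (hj : j ≤ n) {p : Polynomial ℚ} (hp : p.natDegree ≤ n)
    (hval : ∀ l ≤ n, ∃ z : ℤ, p.eval (-(l : ℚ)) = n.factorial * z) :
    shift j p * ∏ l ∈ (Finset.range (n + 1)).erase j, linInv ((l : ℚ) - j) ∈
      denomSubring (dlcm n) := by
  have hinj : Set.InjOn (fun l : ℕ => -(l : ℚ)) (Finset.range (n + 1)) := by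
    intro x _ y _ h
    simpa using h
  have hdeg : p.degree < (Finset.range (n + 1)).card := by
    rw [Finset.card_range]
    exact Polynomial.degree_le_natDegree.trans_lt (by exact_mod_cast Nat.lt_succ_of_le hp)
  have hbasis : ∀ l, shift j (Lagrange.basis (Finset.range (n + 1)) (fun l : ℕ => -(l : ℚ)) l) =
      PowerSeries.C (∏ i ∈ (Finset.range (n + 1)).erase l, ((i : ℚ) - l))⁻¹ *
        ∏ i ∈ (Finset.range (n + 1)).erase l, lin ((i : ℚ) - j) := by
    intro l
    rw [Lagrange.basis, map_prod, ← Finset.prod_inv_distrib, map_prod, ← Finset.prod_mul_distrib]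
    refine Finset.prod_congr rfl fun i _ => ?_
    have : Lagrange.basisDivisor (-(l : ℚ)) (-(i : ℚ)) =
        Polynomial.C ((i : ℚ) - l)⁻¹ * (Polynomial.X + Polynomial.C (i : ℚ)) := by
      rw [Lagrange.basisDivisor, Polynomial.C_neg, sub_neg_eq_add, sub_neg_eq_add,
        neg_add_eq_sub]
    rw [this, map_mul, shift_C, shift_X_add_C]
  rw [Lagrange.eq_interpolate hinj hdeg, Lagrange.interpolate_apply, map_sum, Finset.sum_mul]
  refine sum_mem fun l hl => ?_
  have hl' : l ≤ n := Nat.lt_succ_iff.1 (Finset.mem_range.1 hl)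
  obtain ⟨z, hz⟩ := hval l hl'
  rw [map_mul, hbasis, shift_C, hz, ← mul_assoc, ← map_mul, mul_assoc]
  refine mul_mem ?_ ?_
  · rw [prod_erase_sub hl']
    have : (n.factorial : ℚ) * z *
        ((-1) ^ l * ((l.factorial : ℚ) * ((n - l).factorial : ℚ)))⁻¹ =
        ((z * ((-1) ^ l * n.choose l) : ℤ) : ℚ) := by
      rw [← Nat.choose_mul_factorial_mul_factorial hl']
      push_cast
      have : ((-1 : ℚ) ^ l)⁻¹ = (-1) ^ l := by
        rw [← inv_pow]
        norm_num
      rw [mul_inv, this]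
      field_simp
    rw [this]
    exact C_int_mem_denomSubring _ _
  · rcases eq_or_ne l j with rfl | hne
    · rw [prod_lin_mul_prod_linInv]
      exact one_mem _
    · have hj' : j ∈ Finset.range (n + 1) := Finset.mem_range.2 (by omega)
      rw [← Finset.mul_prod_erase _ _ (Finset.mem_erase.2 ⟨hne.symm, hj'⟩),
        ← Finset.mul_prod_erase ((Finset.range (n + 1)).erase j) _ (Finset.mem_erase.2 ⟨hne, hl⟩),
        Finset.erase_right_comm, mul_mul_mul_comm, ← Finset.prod_mul_distrib,
        Finset.prod_eq_one, mul_one, sub_self]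
      · have := X_mul_linInv_mem_denomSubring (sub_dvd_dlcm hj hl' hne)
        push_cast at this
        simpa [lin] using this
      · intro i hi
        refine lin_mul_linInv ?_
        rw [sub_ne_zero]
        exact_mod_cast (Finset.mem_erase.1 (Finset.mem_erase.1 hi).2).1

lemma prod_lin_mul_prod_linInv_mem {n j : ℕ} (hj : j ≤ n) (u : ℤ) :
    (∏ i ∈ Finset.range n, lin ((u : ℚ) + i - j)) *
      ∏ l ∈ (Finset.range (n + 1)).erase j, linInv ((l : ℚ) - j) ∈ denomSubring (dlcm n) := by
  have h := shift_mul_prod_linInv_mem hj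
    (p := ∏ i ∈ Finset.range n, (Polynomial.X + Polynomial.C ((u : ℚ) + i))) ?_ ?_
  · rw [map_prod] at h
    simpa only [shift_X_add_C] using h
  · rw [Polynomial.natDegree_prod_of_monic _ _ fun _ _ => Polynomial.monic_X_add_C _]
    simp only [Polynomial.natDegree_X_add_C, Finset.sum_const, Finset.card_range, smul_eq_mul,
      mul_one, le_refl]
  · intro l _
    obtain ⟨z, hz⟩ := Nat.factorial_coe_dvd_prod n (u - l)
    refine ⟨z, ?_⟩
    have hz' : ((∏ i ∈ Finset.range n, (u - l + i) : ℤ) : ℚ) = n.factorial * z := by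
      exact_mod_cast congrArg (Int.cast (R := ℚ)) hz
    rw [← hz', Polynomial.eval_prod]
    push_cast
    refine Finset.prod_congr rfl fun i _ => ?_
    simp
    ring

lemma C_factorial_mul_prod_linInv_mem {n j : ℕ} (hj : j ≤ n) :
    PowerSeries.C (n.factorial : ℚ) *
      ∏ l ∈ (Finset.range (n + 1)).erase j, linInv ((l : ℚ) - j) ∈ denomSubring (dlcm n) := by
  have h := shift_mul_prod_linInv_mem hj (p := Polynomial.C (n.factorial : ℚ)) (by simp)
    (fun l _ => ⟨1, by simp⟩)
  rwa [shift_C] at h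

lemma prod_range_mul {M : Type*} [CommMonoid M] (f : ℕ → M) (r n : ℕ) :
    ∏ i ∈ Finset.range (r * n), f i =
      ∏ s ∈ Finset.range r, ∏ i ∈ Finset.range n, f (s * n + i) := by
  induction r with
  | zero => simp
  | succ r ih => rw [add_mul, one_mul, Finset.prod_range_add, ih, Finset.prod_range_succ]

theorem poleSeries_mem {a r n j : ℕ} (hra : 2 * r ≤ a) (hj : j ≤ n) :
    poleSeries a r n j ∈ denomSubring (dlcm n) := by
  obtain ⟨b, rfl⟩ := Nat.exists_eq_add_of_le hra
  rw [poleSeries, prod_range_mul, prod_range_mul, Nat.add_sub_cancel_left]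
  set L := ∏ l ∈ (Finset.range (n + 1)).erase j, linInv ((l : ℚ) - j) with hL
  have h1 : ∀ s, (∏ i ∈ Finset.range n, lin (((s * n + i : ℕ) : ℚ) - r * n - j)) * L ∈
      denomSubring (dlcm n) := by
    intro s
    have := prod_lin_mul_prod_linInv_mem hj ((s : ℤ) * n - r * n)
    convert this using 4
    push_cast
    ring
  have h2 : ∀ s, (∏ i ∈ Finset.range n, lin ((n : ℚ) + 1 + ((s * n + i : ℕ) : ℚ) - j)) * L ∈
      denomSubring (dlcm n) := by
    intro s
    have := prod_lin_mul_prod_linInv_mem hj ((n : ℤ) + 1 + s * n)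
    convert this using 4
    push_cast
    ring
  have h3 : PowerSeries.C ((n : ℚ) - 2 * j) + PowerSeries.C 2 * PowerSeries.X ∈
      denomSubring (dlcm n) := by
    have e1 := C_int_mem_denomSubring (dlcm n) ((n : ℤ) - 2 * j)
    have e2 := C_int_mem_denomSubring (dlcm n) 2
    push_cast at e1 e2
    exact add_mem e1 (mul_mem e2 (X_mem_denomSubring _))
  have h4 := mul_mem (mul_mem (mul_mem (pow_mem (C_factorial_mul_prod_linInv_mem hj) b) h3)
    (prod_mem fun s (_ : s ∈ Finset.range r) => h1 s))
    (prod_mem fun s (_ : s ∈ Finset.range r) => h2 s)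
  convert h4 using 1
  rw [Finset.prod_mul_distrib, Finset.prod_mul_distrib, Finset.prod_const, Finset.card_range,
    ← hL, map_pow]
  ring

lemma rescale_neg_one_lin (x : ℚ) : PowerSeries.rescale (-1) (lin x) = -lin (-x) := by
  ext m
  rw [PowerSeries.coeff_rescale, lin, lin, map_neg, map_add, map_add, PowerSeries.coeff_C,
    PowerSeries.coeff_C, PowerSeries.coeff_X]
  rcases m with _ | _ | m <;> simp

lemma rescale_neg_one_linInv (x : ℚ) : PowerSeries.rescale (-1) (linInv x) = -linInv (-x) := by
  ext m
  rw [PowerSeries.coeff_rescale, linInv, linInv, map_neg, PowerSeries.coeff_mk,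
    PowerSeries.coeff_mk, neg_pow x, pow_succ (-1 : ℚ) m, mul_neg_one, neg_mul, div_neg, neg_neg,
    ← mul_div_assoc, ← mul_pow, neg_one_mul, neg_neg, one_pow, ← div_div,
    div_self (pow_ne_zero _ (by norm_num))]

/-- `R_n(-n-k) = -R_n(k)` for `a` even. -/
lemma poleSeries_sub {a r n j : ℕ} (ha : Even a) (hj : j ≤ n) :
    poleSeries a r n (n - j) = -PowerSeries.rescale (-1) (poleSeries a r n j) := by
  have hC : ∀ x : ℚ, PowerSeries.rescale (-1) (PowerSeries.C x) = PowerSeries.C x := by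
    intro x
    ext m
    rw [PowerSeries.coeff_rescale, PowerSeries.coeff_C]
    split_ifs with h <;> simp [h]
  have hX : PowerSeries.rescale (-1) (PowerSeries.X : PowerSeries ℚ) = -PowerSeries.X := by
    ext m
    rw [PowerSeries.coeff_rescale, map_neg, PowerSeries.coeff_X]
    split_ifs with h <;> simp [h]
  have h1 : ∏ i ∈ Finset.range (r * n), lin (-((i : ℚ) - r * n - j)) =
      ∏ i ∈ Finset.range (r * n), lin ((n : ℚ) + 1 + i - (n - j : ℕ)) := by
    rw [← Finset.prod_range_reflect]
    refine Finset.prod_congr rfl fun i hi => ?_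
    have := Finset.mem_range.1 hi
    rw [Nat.cast_sub (by omega), Nat.cast_sub (by omega), Nat.cast_sub hj]
    push_cast
    congr 1
    ring
  have h2 : ∏ i ∈ Finset.range (r * n), lin (-((n : ℚ) + 1 + i - j)) =
      ∏ i ∈ Finset.range (r * n), lin ((i : ℚ) - r * n - (n - j : ℕ)) := by
    rw [← Finset.prod_range_reflect]
    refine Finset.prod_congr rfl fun i hi => ?_
    have := Finset.mem_range.1 hi
    rw [Nat.cast_sub (by omega), Nat.cast_sub (by omega), Nat.cast_sub hj]
    push_cast
    congr 1
    ring
  have h3 : ∏ l ∈ (Finset.range (n + 1)).erase j, linInv (-((l : ℚ) - j)) =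
      ∏ l ∈ (Finset.range (n + 1)).erase (n - j), linInv ((l : ℚ) - (n - j : ℕ)) := by
    refine Finset.prod_nbij' (fun l => n - l) (fun l => n - l) ?_ ?_ ?_ ?_ ?_
    · intro l hl
      simp only [Finset.mem_erase, Finset.mem_range] at hl ⊢
      omega
    · intro l hl
      simp only [Finset.mem_erase, Finset.mem_range] at hl ⊢
      omega
    · intro l hl
      simp only [Finset.mem_erase, Finset.mem_range] at hl ⊢
      omega
    · intro l hl
      simp only [Finset.mem_erase, Finset.mem_range] at hl ⊢
      omega
    · intro l hl
      simp only [Finset.mem_erase, Finset.mem_range] at hl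
      rw [Nat.cast_sub (by omega), Nat.cast_sub hj]
      congr 1
      ring
  have h4 : PowerSeries.C ((n : ℚ) - 2 * j) + PowerSeries.C 2 * -PowerSeries.X =
      -(PowerSeries.C ((n : ℚ) - 2 * (n - j : ℕ)) + PowerSeries.C 2 * PowerSeries.X) := by
    rw [Nat.cast_sub hj, neg_add, ← map_neg, mul_neg]
    congr 2
    ring
  simp only [poleSeries, map_mul, map_add, map_prod, map_pow, rescale_neg_one_lin,
    rescale_neg_one_linInv, Finset.prod_neg, hC, hX]
  rw [← map_pow, h1, h2, h3, h4, mul_pow _ _ a, ← pow_mul, mul_comm _ a, (ha.mul_right _).neg_one_pow]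
  have hs : ((-1 : PowerSeries ℚ) ^ (Finset.range (r * n)).card) *
      (-1) ^ (Finset.range (r * n)).card = 1 := by
    rw [← mul_pow]
    simp
  linear_combination (-PowerSeries.C ((n.factorial : ℚ) ^ (a - 2 * r)) *
    (PowerSeries.C ((n : ℚ) - 2 * (n - j : ℕ)) + PowerSeries.C 2 * PowerSeries.X) *
    (∏ i ∈ Finset.range (r * n), lin ((i : ℚ) - r * n - (n - j : ℕ))) *
    (∏ i ∈ Finset.range (r * n), lin ((n : ℚ) + 1 + i - (n - j : ℕ))) *
    (∏ l ∈ (Finset.range (n + 1)).erase (n - j), linInv ((l : ℚ) - (n - j : ℕ))) ^ a) * hs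

lemma sum_coeff_even {a r n m : ℕ} (ha : Even a) (hm : Even m) :
    ∑ j ∈ Finset.range (n + 1), PowerSeries.coeff m (poleSeries a r n j) = 0 := by
  have h : ∑ j ∈ Finset.range (n + 1), PowerSeries.coeff m (poleSeries a r n j) =
      -∑ j ∈ Finset.range (n + 1), PowerSeries.coeff m (poleSeries a r n j) := by
    conv_lhs => rw [← Finset.sum_flip]
    rw [← Finset.sum_neg_distrib]
    refine Finset.sum_congr rfl fun j hj => ?_
    rw [poleSeries_sub ha (Nat.lt_succ_iff.1 (Finset.mem_range.1 hj)), map_neg,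
      PowerSeries.coeff_rescale, hm.neg_one_pow, one_mul]
  linarith

/-- The coefficients of the linear form `S_n(1)` in `1, ζ(3), …, ζ(a-1)`. -/
noncomputable def kappa (a r n i : ℕ) : ℚ :=
  if i = 0 then
    -∑ j ∈ Finset.range (n + 1), ∑ m ∈ Finset.range a, PowerSeries.coeff m (poleSeries a r n j) *
      ∑ l ∈ Finset.range j, 1 / ((l : ℚ) + 1) ^ (a - m)
  else ∑ j ∈ Finset.range (n + 1), PowerSeries.coeff (a - i) (poleSeries a r n j)

lemma tendsto_sum_inv_pow {i : ℕ} (hi : 2 ≤ i) (j : ℕ) :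
    Tendsto (fun N : ℕ => ∑ q ∈ Finset.range N, 1 / ((q : ℝ) + 1 + j) ^ i) atTop
      (nhds (zetaR i - ∑ l ∈ Finset.range j, 1 / ((l : ℝ) + 1) ^ i)) := by
  have hs : Summable fun q : ℕ => 1 / ((q : ℝ) + 1) ^ i := by
    have h := (summable_nat_add_iff 1).2 (Real.summable_one_div_nat_pow.2 (by omega : 1 < i))
    simpa using h
  have h := (tendsto_add_atTop_iff_nat j).2 hs.hasSum.tendsto_sum_nat
  refine (h.sub_const (∑ l ∈ Finset.range j, 1 / ((l : ℝ) + 1) ^ i)).congr fun N => ?_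
  rw [add_comm N j, Finset.sum_range_add, add_sub_cancel_left]
  refine Finset.sum_congr rfl fun q _ => ?_
  push_cast
  ring

lemma tendsto_sum_inv_sub (j : ℕ) :
    Tendsto (fun N : ℕ => ∑ q ∈ Finset.range N, 1 / ((q : ℝ) + 1 + j) -
      ∑ q ∈ Finset.range N, 1 / ((q : ℝ) + 1)) atTop
      (nhds (-∑ l ∈ Finset.range j, 1 / ((l : ℝ) + 1))) := by
  have h0 : Tendsto (fun N : ℕ => ∑ x ∈ Finset.range j, 1 / (((N + x : ℕ) : ℝ) + 1)) atTop
      (nhds 0) := by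
    rw [← Finset.sum_const_zero (s := Finset.range j)]
    exact tendsto_finsetSum _ fun x _ =>
      (tendsto_add_atTop_iff_nat x).2 tendsto_one_div_add_atTop_nhds_zero_nat
  rw [← zero_sub]
  refine (h0.sub_const _).congr fun N => ?_
  have h1 := Finset.sum_range_add (fun q : ℕ => 1 / ((q : ℝ) + 1)) j N
  have h2 := Finset.sum_range_add (fun q : ℕ => 1 / ((q : ℝ) + 1)) N j
  rw [add_comm N j, h1] at h2
  have h3 : ∑ q ∈ Finset.range N, 1 / (((j + q : ℕ) : ℝ) + 1) =
      ∑ q ∈ Finset.range N, 1 / ((q : ℝ) + 1 + j) :=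
    Finset.sum_congr rfl fun q _ => by
      push_cast
      ring
  rw [h3] at h2
  linarith

lemma hasSum_RR {a r n : ℕ} (hra : 2 * r + 2 ≤ a) (hr : 1 ≤ r) :
    HasSum (fun q : ℕ => RR a r n (q + 1))
      (∑ j ∈ Finset.range (n + 1), ∑ m ∈ Finset.range a,
        ((PowerSeries.coeff m (poleSeries a r n j) : ℚ) : ℝ) *
          ((if a - m = 1 then 0 else zetaR (a - m)) -
            ∑ l ∈ Finset.range j, 1 / ((l : ℝ) + 1) ^ (a - m))) := by
  rw [hasSum_iff_tendsto_nat_of_nonneg fun q => RR_nonneg a r n q]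
  have key : ∀ j ∈ Finset.range (n + 1), ∀ m ∈ Finset.range a,
      Tendsto (fun N : ℕ => ((PowerSeries.coeff m (poleSeries a r n j) : ℚ) : ℝ) *
        (∑ q ∈ Finset.range N, 1 / ((q : ℝ) + 1 + j) ^ (a - m) -
          if a - m = 1 then ∑ q ∈ Finset.range N, 1 / ((q : ℝ) + 1) else 0)) atTop
        (nhds (((PowerSeries.coeff m (poleSeries a r n j) : ℚ) : ℝ) *
          ((if a - m = 1 then 0 else zetaR (a - m)) -
            ∑ l ∈ Finset.range j, 1 / ((l : ℝ) + 1) ^ (a - m)))) := by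
    intro j _ m hm
    have hm := Finset.mem_range.1 hm
    refine Tendsto.const_mul _ ?_
    split_ifs with h
    · simpa [h] using tendsto_sum_inv_sub j
    · simpa using tendsto_sum_inv_pow (by omega : 2 ≤ a - m) j
  refine (tendsto_finsetSum _ fun j hj => tendsto_finsetSum _ fun m hm => key j hj m hm).congr
    fun N => ?_
  simp only [mul_sub, Finset.sum_sub_distrib]
  have h0 : ∑ j ∈ Finset.range (n + 1), ∑ m ∈ Finset.range a,
      ((PowerSeries.coeff m (poleSeries a r n j) : ℚ) : ℝ) *
        (if a - m = 1 then ∑ q ∈ Finset.range N, 1 / ((q : ℝ) + 1) else 0) = 0 := by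
    have h1 : ∀ j ∈ Finset.range (n + 1), ∑ m ∈ Finset.range a,
        ((PowerSeries.coeff m (poleSeries a r n j) : ℚ) : ℝ) *
          (if a - m = 1 then ∑ q ∈ Finset.range N, 1 / ((q : ℝ) + 1) else 0) =
        ((PowerSeries.coeff (a - 1) (poleSeries a r n j) : ℚ) : ℝ) *
          ∑ q ∈ Finset.range N, 1 / ((q : ℝ) + 1) := by
      intro j _
      rw [Finset.sum_eq_single (a - 1), if_pos (by omega)]
      · intro m hm hne
        have := Finset.mem_range.1 hm
        rw [if_neg (by omega), mul_zero]
      · intro h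
        simp at h
        omega
    rw [Finset.sum_congr rfl h1, ← Finset.sum_mul, ← Rat.cast_sum, sum_coeff_pred hra hr]
    simp
  rw [h0, sub_zero]
  simp only [RR_eq_sum hra hr, Finset.mul_sum, mul_one_div]
  rw [Finset.sum_comm (s := Finset.range N)]
  refine Finset.sum_congr rfl fun j _ => ?_
  rw [Finset.sum_comm]

theorem SS_one_eq {a r n : ℕ} (hra : 2 * r + 2 ≤ a) (hr : 1 ≤ r) (ha : Even a) :
    SS a r n 1 = (kappa a r n 0 : ℝ) +
      ∑ i ∈ (Finset.range a).filter (fun i => Odd i ∧ 3 ≤ i), (kappa a r n i : ℝ) * zetaR i := by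
  rw [SS_one, (hasSum_RR hra hr).tsum_eq]
  simp only [mul_sub, Finset.sum_sub_distrib]
  rw [sub_eq_neg_add]
  congr 1
  · rw [kappa, if_pos rfl]
    push_cast
    rfl
  · rw [Finset.sum_comm]
    symm
    refine Finset.sum_of_injOn (fun i => a - i) ?_ ?_ ?_ ?_
    · intro i hi k hk h
      simp only [Finset.coe_filter, Finset.mem_range, Set.mem_ofPred_eq] at hi hk h
      omega
    · intro i hi
      simp only [Finset.coe_filter, Finset.mem_range, Set.mem_ofPred_eq, Finset.coe_range,
        Set.mem_Iio] at hi ⊢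
      omega
    · intro m hm hm'
      have hm := Finset.mem_range.1 hm
      rw [← Finset.sum_mul, ← Rat.cast_sum]
      rcases Nat.even_or_odd m with he | ho
      · rw [sum_coeff_even ha he, Rat.cast_zero, zero_mul]
      · rw [if_pos, mul_zero]
        by_contra hne
        refine hm' ⟨a - m, ?_, by simp only; omega⟩
        have hodd : Odd (a - m) := Nat.Even.sub_odd hm.le ha ho
        have h2 := ho.pos
        obtain ⟨k, hk⟩ := id hodd
        simp only [Finset.coe_filter, Finset.mem_range, Set.mem_ofPred_eq]
        exact ⟨by omega, hodd, by omega⟩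
    · intro i hi
      simp only [Finset.mem_filter, Finset.mem_range] at hi
      rw [kappa, if_neg (by omega), Nat.sub_sub_self hi.1.le, if_neg (by omega), ← Finset.sum_mul,
        Rat.cast_sum]

lemma abs_kappa_le {a r n : ℕ} (ha : 1 ≤ a) (hra : 2 * r ≤ a) (i : ℕ) :
    |kappa a r n i| ≤ a * (n + 1) ^ 2 * ((n + 2) *
      (2 ^ (a - 2 * r) * (2 * r + 1 : ℚ) ^ (2 * r + 1)) ^ n * (1 + (2 * r + a) * n) ^ a) := by
  set B : ℚ := (n + 2) * (2 ^ (a - 2 * r) * (2 * r + 1 : ℚ) ^ (2 * r + 1)) ^ n *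
    (1 + (2 * r + a) * n) ^ a with hB
  have hB0 : 0 ≤ B := by positivity
  have hc : ∀ j ∈ Finset.range (n + 1), ∀ m ≤ a,
      |PowerSeries.coeff m (poleSeries a r n j)| ≤ B := by
    intro j hj m hm
    refine (abs_coeff_poleSeries_le hra (Nat.lt_succ_iff.1 (Finset.mem_range.1 hj)) m).trans ?_
    refine mul_le_mul_of_nonneg_left (pow_le_pow_right₀ ?_ hm) (by positivity)
    have : (0 : ℚ) ≤ (2 * r + a) * n := by positivity
    linarith
  rw [kappa]
  split_ifs with h
  · rw [abs_neg]
    have hin : ∀ j ∈ Finset.range (n + 1), ∀ m ∈ Finset.range a,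
        |PowerSeries.coeff m (poleSeries a r n j) *
          ∑ l ∈ Finset.range j, 1 / ((l : ℚ) + 1) ^ (a - m)| ≤ B * (n + 1) := by
      intro j hj m hm
      rw [abs_mul]
      refine mul_le_mul (hc j hj m (Finset.mem_range.1 hm).le) ?_ (abs_nonneg _) hB0
      refine (Finset.abs_sum_le_sum_abs _ _).trans
        ((Finset.sum_le_card_nsmul _ _ 1 fun l _ => ?_).trans ?_)
      · rw [abs_of_nonneg (by positivity), div_le_one (by positivity)]
        refine one_le_pow₀ ?_
        have : (0 : ℚ) ≤ l := by positivity
        linarith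
      · rw [Finset.card_range, nsmul_eq_mul, mul_one]
        exact_mod_cast (Finset.mem_range.1 hj).le
    refine (Finset.abs_sum_le_sum_abs _ _).trans
      ((Finset.sum_le_card_nsmul _ _ (a * (B * (n + 1))) fun j hj => ?_).trans ?_)
    · refine (Finset.abs_sum_le_sum_abs _ _).trans
        ((Finset.sum_le_card_nsmul _ _ _ (hin j hj)).trans ?_)
      rw [Finset.card_range, nsmul_eq_mul]
    · rw [Finset.card_range, nsmul_eq_mul]
      push_cast
      exact le_of_eq (by ring)
  · refine (Finset.abs_sum_le_sum_abs _ _).trans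
      ((Finset.sum_le_card_nsmul _ _ B fun j hj => hc j hj _ (Nat.sub_le a i)).trans ?_)
    rw [Finset.card_range, nsmul_eq_mul]
    refine mul_le_mul_of_nonneg_right ?_ hB0
    push_cast
    have h1 : (1 : ℚ) ≤ a := by exact_mod_cast ha
    have h2 : (0 : ℚ) ≤ n := by positivity
    nlinarith [mul_nonneg (sub_nonneg.2 h1) (sq_nonneg ((n : ℚ) + 1))]

lemma limsup_abs_rpow_le {x : ℕ → ℝ} {C Λ : ℝ} (hC : 0 < C) (hΛ : 0 ≤ Λ) (D : ℕ)
    (h : ∀ n : ℕ, 1 ≤ n → |x n| ≤ C * (n : ℝ) ^ D * Λ ^ n) :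
    limsup (fun n : ℕ => |x n| ^ (1 / (n : ℝ))) atTop ≤ Λ := by
  have h1 : Tendsto (fun n : ℕ => (C * (n : ℝ) ^ D) ^ (1 / (n : ℝ)) * Λ) atTop (nhds Λ) := by
    simpa using (tendsto_const_mul_pow_rpow_inv hC D).mul_const Λ
  rw [← h1.limsup_eq]
  refine limsup_le_limsup ?_ ?_ h1.isBoundedUnder_le
  · filter_upwards [eventually_ge_atTop 1] with n hn
    refine (Real.rpow_le_rpow (abs_nonneg _) (h n hn) (by positivity)).trans (le_of_eq ?_)
    rw [Real.mul_rpow (by positivity) (by positivity), one_div,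
      Real.pow_rpow_inv_natCast hΛ (by omega)]
  · exact isCoboundedUnder_le_of_le atTop (x := 0) fun n => by positivity

theorem limsup_kappa_le {a r : ℕ} (ha : 1 ≤ a) (hra : 2 * r ≤ a) (i : ℕ) :
    limsup (fun n : ℕ => |(kappa a r n i : ℝ)| ^ (1 / (n : ℝ))) atTop ≤
      2 ^ (a - 2 * r) * (2 * r + 1 : ℝ) ^ (2 * r + 1) := by
  have ha' : (1 : ℝ) ≤ a := by exact_mod_cast ha
  refine limsup_abs_rpow_le (C := a * 2 ^ 2 * (3 * (1 + (2 * r + a)) ^ a)) (by positivity)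
    (by positivity) (3 + a) fun n hn => ?_
  have hn' : (1 : ℝ) ≤ n := by exact_mod_cast hn
  have h : |(kappa a r n i : ℝ)| ≤ a * (n + 1) ^ 2 * ((n + 2) *
      (2 ^ (a - 2 * r) * (2 * r + 1 : ℝ) ^ (2 * r + 1)) ^ n * (1 + (2 * r + a) * n) ^ a) := by
    exact_mod_cast abs_kappa_le (n := n) ha hra i
  refine h.trans ?_
  calc _ ≤ (a : ℝ) * (2 * n) ^ 2 * ((3 * n) *
        (2 ^ (a - 2 * r) * (2 * r + 1 : ℝ) ^ (2 * r + 1)) ^ n * ((1 + (2 * r + a)) * n) ^ a) := by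
        gcongr
        · linarith
        · linarith
        · linarith
    _ = _ := by
        rw [mul_pow _ (n : ℝ) a, pow_add]
        ring

lemma dlcm_pow_mul_coeff {a r n j : ℕ} (hra : 2 * r ≤ a) (hj : j ≤ n) (m : ℕ) :
    (dlcm n : ℚ) ^ m * PowerSeries.coeff m (poleSeries a r n j) ∈ (Int.castRingHom ℚ).range := by
  obtain ⟨z, hz⟩ := mem_denomSubring.1 (poleSeries_mem hra hj) m
  exact ⟨z, hz.symm⟩

theorem dlcm_pow_mul_kappa {a r : ℕ} (hra : 2 * r ≤ a) (n i : ℕ) :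
    ∃ z : ℤ, (dlcm n : ℚ) ^ a * kappa a r n i = z := by
  suffices h : (dlcm n : ℚ) ^ a * kappa a r n i ∈ (Int.castRingHom ℚ).range by
    obtain ⟨z, hz⟩ := h
    exact ⟨z, hz.symm⟩
  have hd : (dlcm n : ℚ) ∈ (Int.castRingHom ℚ).range := natCast_mem _ _
  have hj : ∀ j ∈ Finset.range (n + 1), j ≤ n := fun j hj =>
    Nat.lt_succ_iff.1 (Finset.mem_range.1 hj)
  rw [kappa]
  split_ifs with h
  · rw [mul_neg, Finset.mul_sum]
    refine neg_mem (sum_mem fun j hjn => ?_)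
    rw [Finset.mul_sum]
    refine sum_mem fun m hm => ?_
    have e : (dlcm n : ℚ) ^ a = (dlcm n : ℚ) ^ m * (dlcm n : ℚ) ^ (a - m) := by
      rw [← pow_add, Nat.add_sub_cancel' (Finset.mem_range.1 hm).le]
    rw [e, mul_mul_mul_comm, Finset.mul_sum]
    refine mul_mem (dlcm_pow_mul_coeff hra (hj j hjn) m) (sum_mem fun l hl => ?_)
    have hl : l < j := Finset.mem_range.1 hl
    have hjn := hj j hjn
    obtain ⟨y, hy⟩ : l + 1 ∣ dlcm n :=
      Finset.dvd_lcm (f := id) (Finset.mem_Icc.2 ⟨by omega, by omega⟩)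
    rw [hy, mul_one_div, ← div_pow]
    push_cast
    rw [mul_div_cancel_left₀ _ (by positivity)]
    exact pow_mem (natCast_mem _ y) _
  · rw [Finset.mul_sum]
    refine sum_mem fun j hjn => ?_
    rw [← Nat.add_sub_cancel' (Nat.sub_le a i), pow_add, mul_right_comm]
    exact mul_mem (by simpa using dlcm_pow_mul_coeff hra (hj j hjn) (a - i)) (pow_mem hd _)

end Rivoal

/-- For `a` even, there are rationals `κ_j = κ_j(n)` (`j ∈ {0, 3, 5, …, a-1}`) with:
(1) `S_n(1) = κ₀ + κ₃ ζ(3) + ⋯ + κ_{a-1} ζ(a-1)` (for even `n ≥ 1`);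
(2) `limsup_n |κ_j|^{1/n} ≤ 2^{a-2r}(2r+1)^{2r+1}`;
(3) `d_n^a κ_j ∈ ℤ`;
(4) `|S_n(1)|^{1/n}` converges to some `ψ_{r,a} > 0` with `ψ_{r,a} ≤ 2^{r+1}/r^{a-2r}`. -/
theorem proposition_rivoal (a r : ℕ) (ha : 3 ≤ a) (hr : 1 ≤ r) (hra : 2 * r < a)
    (haeven : Even a) :
    ∃ κ : ℕ → ℕ → ℚ,
      (∀ n : ℕ, 1 ≤ n → Even n →
        SS a r n 1 = (κ n 0 : ℝ) +
          ∑ j ∈ (Finset.range a).filter (fun j => Odd j ∧ 3 ≤ j),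
            (κ n j : ℝ) * zetaR j) ∧
      (∀ j ∈ idxSet a,
        limsup (fun n : ℕ => |(κ n j : ℝ)| ^ (1 / (n : ℝ))) atTop ≤
          2 ^ (a - 2 * r) * (2 * r + 1 : ℝ) ^ (2 * r + 1)) ∧
      (∀ n : ℕ, 1 ≤ n → Even n → ∀ j ∈ idxSet a,
        ∃ m : ℤ, ((dlcm n : ℚ)) ^ a * κ n j = (m : ℚ)) ∧
      (∃ ψ : ℝ, 0 < ψ ∧
        Tendsto (fun n : ℕ => |SS a r n 1| ^ (1 / (n : ℝ))) atTop (nhds ψ) ∧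
        ψ ≤ 2 ^ (r + 1) / (r : ℝ) ^ (a - 2 * r)) := by
  have hra2 : 2 * r + 2 ≤ a := by
    obtain ⟨k, rfl⟩ := haeven
    omega
  refine ⟨Rivoal.kappa a r, fun n _ _ => Rivoal.SS_one_eq hra2 hr haeven,
    fun j _ => Rivoal.limsup_kappa_le (by omega) hra.le j,
    fun n _ _ j _ => Rivoal.dlcm_pow_mul_kappa hra.le n j,
    Real.exp (Rivoal.maxRate a r), Real.exp_pos _, Rivoal.tendsto_SS_rpow hr hra2, ?_⟩
  have hr0 : (0 : ℝ) < r := by exact_mod_cast hr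
  rw [← Real.le_log_iff_exp_le (by positivity)]
  exact Rivoal.maxRate_le hr hra2
end

section
/- For every j ∈ {0, 1, …, a}, the polynomial d_n^{a−j}·P_j(z) has integer coefficients. -/
/-- The power series `f ∈ ℚ⟦t⟧` such that `f (d t)` has integer coefficients. -/
noncomputable def integralRescale (d : ℕ) : Subring (PowerSeries ℚ) :=
  (PowerSeries.map (Int.castRingHom ℚ)).range.comap (PowerSeries.rescale (d : ℚ))

lemma mem_integralRescale_iff {d : ℕ} {f : PowerSeries ℚ} :
    f ∈ integralRescale d ↔ ∀ m, ∃ z : ℤ, (d : ℚ) ^ m * PowerSeries.coeff m f = z := by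
  simp only [integralRescale, Subring.mem_comap, RingHom.mem_range]
  constructor
  · rintro ⟨g, hg⟩ m
    exact ⟨PowerSeries.coeff m g, by rw [← PowerSeries.coeff_rescale, ← hg]; simp⟩
  · intro h
    choose z hz using h
    exact ⟨PowerSeries.mk z, by ext m; simp [PowerSeries.coeff_rescale, hz]⟩

lemma X_mem_integralRescale (d : ℕ) : (PowerSeries.X : PowerSeries ℚ) ∈ integralRescale d := by
  rw [mem_integralRescale_iff]
  intro m
  rw [PowerSeries.coeff_X]
  split_ifs with h
  · exact ⟨d, by simp [h]⟩
  · exact ⟨0, by simp⟩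

/-- If `c ∣ d`, then `t / (t + c)` becomes integral after substituting `d t`. -/
lemma exists_inverse_X_add_C {d : ℕ} {c : ℤ} (hc : c ≠ 0) (hcd : c ∣ d) :
    ∃ h : PowerSeries ℚ, (PowerSeries.X + PowerSeries.C (c : ℚ)) * h = 1 ∧
      PowerSeries.X * h ∈ integralRescale d := by
  have hc' : (c : ℚ) ≠ 0 := by exact_mod_cast hc
  refine ⟨PowerSeries.mk fun m => (-1) ^ m / (c : ℚ) ^ (m + 1), ?_, ?_⟩
  · ext m
    rw [add_mul, map_add, PowerSeries.coeff_C_mul]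
    cases m with
    | zero => simp [hc']
    | succ m =>
      rw [PowerSeries.coeff_succ_X_mul, PowerSeries.coeff_one, if_neg (by omega)]
      simp only [PowerSeries.coeff_mk]
      field_simp
      ring
  · rw [mem_integralRescale_iff]
    rintro (_ | m)
    · exact ⟨0, by simp⟩
    · obtain ⟨e, he⟩ := hcd
      have hd : (d : ℚ) = c * e := by exact_mod_cast he
      refine ⟨(-1) ^ m * e ^ (m + 1), ?_⟩
      rw [PowerSeries.coeff_succ_X_mul, PowerSeries.coeff_mk, hd]
      push_cast
      rw [mul_pow]
      field_simp

lemma dvd_dlcm {n k : ℕ} (h1 : 1 ≤ k) (h2 : k ≤ n) : k ∣ dlcm n :=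
  Finset.dvd_lcm (f := id) (Finset.mem_Icc.2 ⟨h1, h2⟩)

lemma sub_dvd_dlcm {n i l : ℕ} (hi : i ≤ n) (hl : l ≤ n) (h : i ≠ l) :
    ((i : ℤ) - l) ∣ (dlcm n : ℤ) := by
  rw [← Int.natAbs_dvd_natAbs, Int.natAbs_natCast]
  exact dvd_dlcm (by omega) (by omega)

lemma prod_erase_sub_dvd_factorial {n i : ℕ} (hi : i ≤ n) :
    (∏ l ∈ (Finset.range (n + 1)).erase i, ((l : ℤ) - i)) ∣ (n.factorial : ℤ) := by
  have h1 : ∏ l ∈ (Finset.range (n + 1)).erase i, ((l : ℤ) - i)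
      = (∏ l ∈ Finset.range i, ((l : ℤ) - i)) * ∏ l ∈ Finset.range (n - i), ((l : ℤ) + 1) := by
    have e : (Finset.range (n + 1)).erase i
        = Finset.range i ∪ (Finset.range (n - i)).map (addLeftEmbedding (i + 1)) := by
      ext l
      simp only [Finset.mem_erase, Finset.mem_range, Finset.mem_union, Finset.mem_map,
        addLeftEmbedding_apply]
      constructor
      · rintro ⟨h, h'⟩
        by_cases hl : l < i
        · exact Or.inl hl
        · exact Or.inr ⟨l - (i + 1), by omega, by omega⟩
      · rintro (h | ⟨k, hk, rfl⟩) <;> omega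
    rw [e, Finset.prod_union, Finset.prod_map]
    · congr 1
      refine Finset.prod_congr rfl fun l _ => ?_
      simp only [addLeftEmbedding_apply]
      push_cast
      ring
    · rw [Finset.disjoint_left]
      simp only [Finset.mem_range, Finset.mem_map, addLeftEmbedding_apply]
      rintro l hl ⟨k, -, rfl⟩
      omega
  have h2 : ∏ l ∈ Finset.range (n - i), ((l : ℤ) + 1) = ((n - i).factorial : ℤ) := by
    rw [← Finset.prod_range_add_one_eq_factorial]
    push_cast
    rfl
  have h3 : ∏ l ∈ Finset.range i, ((l : ℤ) - i) = (-1) ^ i * (i.factorial : ℤ) := by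
    rw [← Finset.prod_range_add_one_eq_factorial, ← Finset.prod_range_reflect]
    push_cast
    rw [← Finset.card_range i, ← Finset.prod_const, Finset.card_range, ← Finset.prod_mul_distrib]
    refine Finset.prod_congr rfl fun l hl => ?_
    have := Finset.mem_range.1 hl
    omega
  rw [h1, h2, h3, mul_assoc, (isUnit_neg_one.pow i).mul_left_dvd]
  exact_mod_cast Nat.factorial_mul_factorial_dvd_factorial hi

lemma factorial_dvd_prod_range_add (n : ℕ) (s : ℤ) :
    (n.factorial : ℤ) ∣ ∏ m ∈ Finset.range n, (s + m) := by
  have h := Ring.factorial_nsmul_multichoose_eq_ascPochhammer s n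
  have e : ∀ k : ℕ, (ascPochhammer ℤ k).eval s = ∏ m ∈ Finset.range k, (s + m) := by
    intro k
    induction k with
    | zero => simp
    | succ k ih => rw [ascPochhammer_succ_eval, ih, Finset.prod_range_succ]
  rw [Polynomial.ascPochhammer_smeval_eq_eval, e] at h
  exact ⟨_, by rw [← h, nsmul_eq_mul]⟩

open Polynomial in
/-- `∏_{l ≠ i} (t + l - p)`, for `l` ranging over `0, …, n`. -/
noncomputable def puncturedProd (n p i : ℕ) : ℚ[X] :=
  ∏ l ∈ (Finset.range (n + 1)).erase i, (X - C ((p : ℚ) - l))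

open Polynomial in
lemma exists_quotient_puncturedProd {n p : ℕ} (hp : p ≤ n) {B : ℚ[X]} (hB : B.natDegree ≤ n)
    (hBv : ∀ i : ℕ, i ≤ n → ∃ z : ℤ, B.eval ((p : ℚ) - i) = z ∧ (n.factorial : ℤ) ∣ z) :
    ∃ f ∈ integralRescale (dlcm n),
      (B : PowerSeries ℚ) = f * (puncturedProd n p p : PowerSeries ℚ) := by
  have hint : ∀ i : ℕ, ∃ w : ℤ, i ≤ n → B.eval ((p : ℚ) - i) =
      w * ∏ l ∈ (Finset.range (n + 1)).erase i, ((l : ℚ) - i) := by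
    intro i
    by_cases hi : i ≤ n
    · obtain ⟨z, hz, hd⟩ := hBv i hi
      obtain ⟨w, rfl⟩ := (prod_erase_sub_dvd_factorial hi).trans hd
      exact ⟨w, fun _ => by rw [hz]; push_cast; ring⟩
    · exact ⟨0, fun h => absurd h hi⟩
  choose w hw using hint
  have hBsum : B = ∑ i ∈ Finset.range (n + 1), C (w i : ℚ) * puncturedProd n p i := by
    have hinj : Set.InjOn (fun i : ℕ => (p : ℚ) - i) (Finset.range (n + 1)) := by
      intro x _ y _ h
      simpa using h
    conv_lhs => rw [Lagrange.eq_interpolate (f := B) (s := Finset.range (n + 1)) hinj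
      (lt_of_le_of_lt B.degree_le_natDegree (by
        rw [Finset.card_range]; exact_mod_cast Nat.lt_succ_of_le hB))]
    rw [Lagrange.interpolate_apply]
    refine Finset.sum_congr rfl fun i hi => ?_
    rw [Lagrange.basis, hw i (by simpa [Nat.lt_succ_iff] using hi), puncturedProd]
    simp only [Lagrange.basisDivisor]
    rw [Finset.prod_mul_distrib, ← mul_assoc, C_mul, mul_assoc (C (w i : ℚ)),
      ← map_prod, ← C_mul, ← Finset.prod_mul_distrib, Finset.prod_eq_one, C_1, mul_one]
    intro l hl
    have : (l : ℚ) - i ≠ 0 := sub_ne_zero.2 (by exact_mod_cast (Finset.mem_erase.1 hl).1)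
    rw [show (p : ℚ) - i - (p - l) = l - i by ring, mul_inv_cancel₀ this]
  have hterm : ∀ i ∈ Finset.range (n + 1), ∃ f ∈ integralRescale (dlcm n),
      (puncturedProd n p i : PowerSeries ℚ) = f * (puncturedProd n p p : PowerSeries ℚ) := by
    intro i hi
    by_cases hip : i = p
    · exact ⟨1, one_mem _, by rw [hip, one_mul]⟩
    have hi' : i ≤ n := by simpa [Nat.lt_succ_iff] using hi
    obtain ⟨h, hh, hX⟩ := exists_inverse_X_add_C (d := dlcm n) (c := (i : ℤ) - p)
      (sub_ne_zero.2 (by exact_mod_cast hip)) (sub_dvd_dlcm hi' hp hip)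
    refine ⟨_, hX, ?_⟩
    have e1 : puncturedProd n p i = X * ∏ l ∈ ((Finset.range (n + 1)).erase i).erase p,
        (X - C ((p : ℚ) - l)) := by
      rw [puncturedProd, ← Finset.mul_prod_erase _ _ (a := p)]
      · simp
      · simp; omega
    have e2 : puncturedProd n p p = (X + C (((i : ℤ) - p : ℤ) : ℚ)) *
        ∏ l ∈ ((Finset.range (n + 1)).erase i).erase p, (X - C ((p : ℚ) - l)) := by
      rw [puncturedProd, ← Finset.mul_prod_erase _ _ (a := i), Finset.erase_right_comm]
      · congr 1
        push_cast
        simp only [C_sub]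
        ring
      · simp; omega
    rw [e1, e2, coe_mul, coe_mul, coe_add, coe_X, coe_C, mul_assoc, ← mul_assoc h, mul_comm h, hh,
      one_mul]
  choose! f hf hfe using hterm
  refine ⟨∑ i ∈ Finset.range (n + 1), (w i : PowerSeries ℚ) * f i,
    sum_mem fun i hi => mul_mem (intCast_mem _ _) (hf i hi), ?_⟩
  rw [Finset.sum_mul]
  conv_lhs => rw [hBsum]
  rw [← coeToPowerSeries.ringHom_apply, map_sum]
  refine Finset.sum_congr rfl fun i hi => ?_
  rw [map_mul, coeToPowerSeries.ringHom_apply, coeToPowerSeries.ringHom_apply, hfe i hi, mul_assoc,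
    coe_C, map_intCast]

open Polynomial in
lemma exists_quotient_prod_range {n p : ℕ} (hp : p ≤ n) (r : ℕ) (s : ℤ) :
    ∃ f ∈ integralRescale (dlcm n),
      ((∏ m ∈ Finset.range (r * n), (X + C ((s : ℚ) + m)) : ℚ[X]) : PowerSeries ℚ)
        = f * (puncturedProd n p p : PowerSeries ℚ) ^ r := by
  induction r with
  | zero => exact ⟨1, one_mem _, by simp⟩
  | succ r ih =>
    obtain ⟨f, hf, hfe⟩ := ih
    obtain ⟨g, hg, hge⟩ := exists_quotient_puncturedProd hp
      (B := ∏ m ∈ Finset.range n, (X + C (((s : ℚ) + (r * n : ℕ)) + m)))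
      ((natDegree_prod_le _ _).trans (by simp only [natDegree_X_add_C]; simp)) (fun i _ =>
        ⟨∏ m ∈ Finset.range n, (((p : ℤ) - i + s + (r * n : ℕ)) + m), by
          rw [eval_prod]
          push_cast
          refine Finset.prod_congr rfl fun m _ => ?_
          simp
          ring, factorial_dvd_prod_range_add _ _⟩)
    refine ⟨f * g, mul_mem hf hg, ?_⟩
    rw [Nat.succ_mul, Finset.prod_range_add, coe_mul, hfe, pow_succ]
    simp only [add_assoc, Nat.cast_add] at hge ⊢
    rw [hge]
    ring

open Polynomial in
/-- The numerator of `R_n` in the variable `t = X + p`. -/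
noncomputable def shiftedNumerator (a r n p : ℕ) : ℚ[X] :=
  C (n.factorial : ℚ) ^ (a - 2 * r) * (2 * X + C ((n : ℚ) - 2 * p)) *
    (∏ m ∈ Finset.range (r * n), (X + C (((-(r * n) - p : ℤ) : ℚ) + m))) *
    ∏ m ∈ Finset.range (r * n), (X + C (((n + 1 - p : ℤ) : ℚ) + m))

open Polynomial in
lemma exists_quotient_shiftedNumerator {a r n p : ℕ} (hra : 2 * r < a) (hp : p ≤ n) :
    ∃ f ∈ integralRescale (dlcm n), (shiftedNumerator a r n p : PowerSeries ℚ)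
        = f * (puncturedProd n p p : PowerSeries ℚ) ^ a := by
  obtain ⟨f, hf, hfe⟩ := exists_quotient_puncturedProd hp (B := C (n.factorial : ℚ)) (by simp)
    (fun i _ => ⟨n.factorial, by simp, dvd_rfl⟩)
  obtain ⟨g, hg, hge⟩ := exists_quotient_prod_range hp r (-(r * n) - p)
  obtain ⟨h, hh, hhe⟩ := exists_quotient_prod_range hp r (n + 1 - p)
  refine ⟨f ^ (a - 2 * r) * (2 * PowerSeries.X + ((n - 2 * p : ℤ) : PowerSeries ℚ)) * g * h,
    mul_mem (mul_mem (mul_mem (pow_mem hf _) (add_mem (mul_mem (ofNat_mem _ 2)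
      (X_mem_integralRescale _)) (intCast_mem _ _))) hg) hh, ?_⟩
  have e : ((2 * X + C ((n : ℚ) - 2 * p) : ℚ[X]) : PowerSeries ℚ)
      = 2 * PowerSeries.X + ((n - 2 * p : ℤ) : PowerSeries ℚ) := by
    have h2 : ((2 : ℚ[X]) : PowerSeries ℚ) = 2 := map_ofNat (coeToPowerSeries.ringHom (R := ℚ)) 2
    rw [coe_add, coe_mul, coe_X, coe_C, h2,
      ← map_intCast (PowerSeries.C (R := ℚ)) (n - 2 * p : ℤ)]
    push_cast
    rfl
  obtain ⟨b, rfl⟩ : ∃ b, a = b + 2 * r := ⟨a - 2 * r, by omega⟩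
  rw [shiftedNumerator, coe_mul, coe_mul, coe_mul, coe_pow, hfe, hge, hhe, e]
  simp only [Nat.add_sub_cancel]
  ring

open Polynomial in
lemma shiftedNumerator_eq_sum {a r n : ℕ} (p : ℕ) {c : ℕ → ℕ → ℚ}
    (hc : ∀ x : ℝ, (∀ i ∈ Finset.range (n + 1), x + i ≠ 0) →
      RR a r n x = ∑ i ∈ Finset.range (n + 1), ∑ j ∈ Finset.Icc 1 a, (c i j : ℝ) / (x + i) ^ j) :
    shiftedNumerator a r n p = ∑ i ∈ Finset.range (n + 1), ∑ j ∈ Finset.Icc 1 a,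
      C (c i j) * (X - C ((p : ℚ) - i)) ^ (a - j) * puncturedProd n p i ^ a := by
  refine eq_of_infinite_eval_eq _ _ (Set.Infinite.mono ?_
    (Set.infinite_range_of_injective (f := fun k : ℕ => (k : ℚ) + 1 + p) fun x y h => by
      simpa using h))
  rintro _ ⟨k, rfl⟩
  have hne : ∀ i : ℕ, (k : ℚ) + 1 + i ≠ 0 := fun i => by positivity
  have h := hc ((k : ℚ) + 1 : ℚ) (fun i _ => by exact_mod_cast hne i)
  have hP : (∏ l ∈ Finset.range (n + 1), ((k : ℚ) + 1 + l)) ^ a ≠ 0 :=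
    pow_ne_zero _ (Finset.prod_ne_zero_iff.2 fun i _ => hne i)
  simp only [RR, poch] at h
  have h' : 2 * (n.factorial : ℚ) ^ (a - 2 * r) * ((k : ℚ) + 1 + n / 2) *
      (∏ i ∈ Finset.range (r * n), ((k : ℚ) + 1 - r * n + i)) *
      (∏ i ∈ Finset.range (r * n), ((k : ℚ) + 1 + n + 1 + i)) /
      (∏ l ∈ Finset.range (n + 1), ((k : ℚ) + 1 + l)) ^ a =
      ∑ i ∈ Finset.range (n + 1), ∑ j ∈ Finset.Icc 1 a, c i j / ((k : ℚ) + 1 + i) ^ j := by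
    apply Rat.cast_injective (α := ℝ)
    push_cast at h ⊢
    exact h
  rw [div_eq_iff hP, Finset.sum_mul] at h'
  simp only [Set.mem_ofPred_eq, eval_finsetSum]
  have lhs : eval ((k : ℚ) + 1 + p) (shiftedNumerator a r n p) =
      2 * (n.factorial : ℚ) ^ (a - 2 * r) * ((k : ℚ) + 1 + n / 2) *
      (∏ i ∈ Finset.range (r * n), ((k : ℚ) + 1 - r * n + i)) *
      (∏ i ∈ Finset.range (r * n), ((k : ℚ) + 1 + n + 1 + i)) := by
    have e1 : ∀ i : ℕ, (k : ℚ) + 1 + p + (((-(r * n) - p : ℤ) : ℚ) + i)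
        = (k : ℚ) + 1 - r * n + i := fun i => by push_cast; ring
    have e2 : ∀ i : ℕ, (k : ℚ) + 1 + p + (((n + 1 - p : ℤ) : ℚ) + i)
        = (k : ℚ) + 1 + n + 1 + i := fun i => by push_cast; ring
    simp only [shiftedNumerator, eval_mul, eval_pow, eval_prod, eval_add, eval_X, eval_C, e1, e2,
      eval_ofNat]
    ring
  rw [lhs, h']
  refine Finset.sum_congr rfl fun i hi => ?_
  rw [Finset.sum_mul]
  refine Finset.sum_congr rfl fun j hj => ?_
  have e3 : ∀ l : ℕ, (k : ℚ) + 1 + p - (p - l) = (k : ℚ) + 1 + l := fun l => by ring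
  simp only [puncturedProd, eval_mul, eval_pow, eval_prod, eval_sub, eval_X, eval_C, e3]
  rw [← Finset.mul_prod_erase _ _ hi, mul_pow, ← mul_assoc]
  congr 1
  have := hne i
  rw [div_mul_eq_mul_div, div_eq_iff (pow_ne_zero _ this), mul_assoc, ← pow_add,
    Nat.sub_add_cancel (Finset.mem_Icc.1 hj).2]

open Polynomial in
lemma exists_int_eq_dlcm_pow_mul {a r n : ℕ} (hra : 2 * r < a) {c : ℕ → ℕ → ℚ}
    (hc : ∀ x : ℝ, (∀ i ∈ Finset.range (n + 1), x + i ≠ 0) →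
      RR a r n x = ∑ i ∈ Finset.range (n + 1), ∑ j ∈ Finset.Icc 1 a, (c i j : ℝ) / (x + i) ^ j)
    {j p : ℕ} (hj : 1 ≤ j) (hja : j ≤ a) (hp : p ≤ n) :
    ∃ t : ℤ, (dlcm n : ℚ) ^ (a - j) * c p j = t := by
  obtain ⟨f, hf, hfe⟩ := exists_quotient_shiftedNumerator hra hp
  have hpm : p ∈ Finset.range (n + 1) := Finset.mem_range.2 (by omega)
  set G := puncturedProd n p p with hG
  set S : ℚ[X] := ∑ j ∈ Finset.Icc 1 a, C (c p j) * X ^ (a - j) with hS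
  have hdvd : (X : ℚ[X]) ^ a ∣ shiftedNumerator a r n p - S * G ^ a := by
    rw [shiftedNumerator_eq_sum p hc, ← Finset.add_sum_erase _ _ hpm]
    have e : ∑ j ∈ Finset.Icc 1 a, C (c p j) * (X - C ((p : ℚ) - p)) ^ (a - j) *
        puncturedProd n p p ^ a = S * G ^ a := by
      rw [hS, Finset.sum_mul]
      simp [hG]
    rw [e, add_sub_cancel_left]
    refine Finset.dvd_sum fun i hi => Finset.dvd_sum fun j _ => Dvd.dvd.mul_left
      (pow_dvd_pow_of_dvd ?_ a) _
    rw [puncturedProd]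
    have := Finset.dvd_prod_of_mem (fun l : ℕ => (X : ℚ[X]) - C ((p : ℚ) - l))
      (Finset.mem_erase.2 ⟨(Finset.mem_erase.1 hi).1.symm, hpm⟩)
    simpa using this
  obtain ⟨H, hH⟩ := hdvd
  have hunit : IsUnit ((G : PowerSeries ℚ) ^ a) := by
    refine IsUnit.pow _ (PowerSeries.isUnit_iff_constantCoeff.2 (Ne.isUnit ?_))
    rw [← PowerSeries.coeff_zero_eq_constantCoeff_apply, coeff_coe, coeff_zero_eq_eval_zero, hG,
      puncturedProd, eval_prod]
    refine Finset.prod_ne_zero_iff.2 fun l hl => ?_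
    simp only [eval_sub, eval_X, eval_C, zero_sub, neg_sub]
    exact sub_ne_zero.2 (by exact_mod_cast (Finset.mem_erase.1 hl).1)
  have hX : (PowerSeries.X : PowerSeries ℚ) ^ a ∣ f - S := by
    rw [← hunit.dvd_mul_right]
    refine ⟨H, ?_⟩
    rw [sub_mul, ← hfe, ← coe_pow, ← coe_mul, ← coe_sub, hH, coe_mul, coe_pow, coe_X]
  have hcoeff := PowerSeries.X_pow_dvd_iff.1 hX (a - j) (by omega)
  rw [map_sub, sub_eq_zero, coeff_coe, hS, finsetSum_coeff, Finset.sum_eq_single j] at hcoeff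
  · rw [coeff_C_mul_X_pow, if_pos rfl] at hcoeff
    rw [← hcoeff]
    exact mem_integralRescale_iff.1 hf _
  · intro k hk hkj
    have := Finset.mem_Icc.1 hk
    rw [coeff_C_mul_X_pow, if_neg (by omega)]
  · exact fun h => absurd (Finset.mem_Icc.2 ⟨hj, hja⟩) h

/-- If `c n i j` are the partial fraction coefficients of `R_n`, i.e.
`R_n(X) = ∑_{i=0}^n ∑_{j=1}^a c_{i,j}/(X+i)^j`, then for every `j ∈ {0, …, a}` the
polynomial `d_n^{a-j}·P_j(z)` has integer coefficients; explicitly, for `1 ≤ j ≤ a`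
each coefficient `c_{i,j}` of `P_j` satisfies `d_n^{a-j} c_{i,j} ∈ ℤ`, and each
coefficient `-∑_{i=ℓ+1}^n ∑_{j'=1}^a c_{i,j'}/(i-ℓ)^{j'}` of `P₀` becomes an
integer after multiplication by `d_n^a`. -/
theorem lemma_arithmetic (a r n : ℕ) (ha : 3 ≤ a) (hr : 1 ≤ r) (hra : 2 * r < a)
    (hn : 1 ≤ n) (c : ℕ → ℕ → ℕ → ℚ)
    (hc : ∀ m : ℕ, 1 ≤ m → ∀ x : ℝ, (∀ i ∈ Finset.range (m + 1), x + i ≠ 0) →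
      RR a r m x =
        ∑ i ∈ Finset.range (m + 1), ∑ j ∈ Finset.Icc 1 a,
          (c m i j : ℝ) / (x + i) ^ j) :
    (∀ j : ℕ, 1 ≤ j → j ≤ a → ∀ i : ℕ, i ≤ n →
      ∃ t : ℤ, ((dlcm n : ℚ)) ^ (a - j) * c n i j = (t : ℚ)) ∧
    (∀ l : ℕ, l < n →
      ∃ t : ℤ, ((dlcm n : ℚ)) ^ a *
        (- ∑ i ∈ Finset.Icc (l + 1) n, ∑ j' ∈ Finset.Icc 1 a,
            c n i j' / ((i : ℚ) - l) ^ j') = (t : ℚ)) := by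
  have key : ∀ j : ℕ, 1 ≤ j → j ≤ a → ∀ i : ℕ, i ≤ n →
      ∃ t : ℤ, ((dlcm n : ℚ)) ^ (a - j) * c n i j = (t : ℚ) := fun j hj hja i hi =>
    exists_int_eq_dlcm_pow_mul hra (hc n hn) hj hja hi
  refine ⟨key, fun l hl => ?_⟩
  suffices h : (dlcm n : ℚ) ^ a * (- ∑ i ∈ Finset.Icc (l + 1) n, ∑ j' ∈ Finset.Icc 1 a,
      c n i j' / ((i : ℚ) - l) ^ j') ∈ (Int.castRingHom ℚ).range by
    obtain ⟨t, ht⟩ := h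
    exact ⟨t, ht.symm⟩
  rw [mul_neg, Finset.mul_sum]
  refine neg_mem (sum_mem fun i hi => ?_)
  rw [Finset.mul_sum]
  refine sum_mem fun j hj => ?_
  rw [Finset.mem_Icc] at hi hj
  obtain ⟨t, ht⟩ := key j hj.1 hj.2 i hi.2
  obtain ⟨e, he⟩ := sub_dvd_dlcm hi.2 hl.le (by omega : i ≠ l)
  have he' : (dlcm n : ℚ) = ((i : ℚ) - l) * e := by exact_mod_cast he
  have hne : (i : ℚ) - l ≠ 0 := sub_ne_zero.2 (by exact_mod_cast (by omega : i ≠ l))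
  refine ⟨t * e ^ j, ?_⟩
  rw [eq_intCast, Int.cast_mul, ← ht, Int.cast_pow]
  conv_rhs => rw [← Nat.sub_add_cancel hj.2, pow_add]
  rw [mul_assoc, mul_assoc]
  congr 1
  rw [he', mul_pow]
  field_simp
end

section
/- ζ(3) = (5/2)·Σ_{n≥1} (−1)^{n−1} / (n³·C(2n,n)), where C(2n,n) is the central binomial coefficient. -/
open Filter Topology Finset Nat

/-- The Apéry correction term `(k!)² (n - k)! / (2 k³ (n + k)!)` with `k = i + 1`. -/
noncomputable def aperyTerm (n i : ℕ) : ℝ :=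
  ((i + 1)! : ℝ) ^ 2 * ((n - (i + 1))! : ℝ) / (2 * (i + 1 : ℝ) ^ 3 * ((n + (i + 1))! : ℝ))

/-- The telescoping identity for the differences of the Apéry correction terms. -/
theorem sum_aperyTerm_succ_sub (n m : ℕ) (hm : m ≤ n) :
    ∑ i ∈ range m, (-1 : ℝ) ^ (i + 1) * (aperyTerm (n + 1) i - aperyTerm n i) =
      1 / (n + 1 : ℝ) ^ 3 -
        (-1) ^ m * (m ! : ℝ) ^ 2 * ((n - m)! : ℝ) / ((n + 1 : ℝ) ^ 2 * ((n + 1 + m)! : ℝ)) := by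
  induction m with
  | zero =>
    have h : (n ! : ℝ) ≠ 0 := by positivity
    simp only [range_zero, sum_empty, pow_zero, Nat.factorial_zero, Nat.sub_zero, Nat.add_zero,
      Nat.factorial_succ]
    push_cast
    field_simp
    ring
  | succ m ih =>
    obtain ⟨j, rfl⟩ := Nat.exists_eq_add_of_le hm
    rw [sum_range_succ, ih (by omega)]
    simp only [aperyTerm]
    rw [show m + 1 + j + 1 - (m + 1) = j + 1 by omega, show m + 1 + j - (m + 1) = j by omega,
      show m + 1 + j - m = j + 1 by omega,
      show m + 1 + j + 1 + (m + 1) = 2 * m + j + 2 + 1 by omega,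
      show m + 1 + j + (m + 1) = 2 * m + j + 2 by omega,
      show m + 1 + j + 1 + m = 2 * m + j + 2 by omega,
      Nat.factorial_succ (2 * m + j + 2), Nat.factorial_succ m, Nat.factorial_succ j]
    have h1 : ((2 * m + j + 2)! : ℝ) ≠ 0 := by positivity
    have h2 : (2 * m + j + 2 + 1 : ℝ) ≠ 0 := by positivity
    have h3 : (m + 1 + j + 1 : ℝ) ≠ 0 := by positivity
    push_cast
    field_simp
    ring

/-- The partial sums of `ζ(3)` in terms of those of the central binomial series. -/
theorem sum_one_div_cube_eq (n : ℕ) :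
    ∑ i ∈ range n, 1 / (i + 1 : ℝ) ^ 3 =
      5 / 2 * ∑ i ∈ range n,
        (-1 : ℝ) ^ i / ((i + 1 : ℝ) ^ 3 * (Nat.choose (2 * (i + 1)) (i + 1) : ℝ)) +
      ∑ i ∈ range n, (-1 : ℝ) ^ (i + 1) * aperyTerm n i := by
  induction n with
  | zero => simp
  | succ n ih =>
    have h := sum_aperyTerm_succ_sub n n le_rfl
    simp only [mul_sub, sum_sub_distrib] at h
    have hc : ((2 * (n + 1)).choose (n + 1) : ℝ) =
        ((2 * n + 1 + 1)! : ℝ) / (((n + 1)! : ℝ) * ((n + 1)! : ℝ)) := by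
      rw [Nat.cast_choose ℝ (by omega), show 2 * (n + 1) - (n + 1) = n + 1 by omega]
      rfl
    have key : 5 / 2 * ((-1 : ℝ) ^ n /
          ((n + 1 : ℝ) ^ 3 * (Nat.choose (2 * (n + 1)) (n + 1) : ℝ))) +
        (-1 : ℝ) ^ (n + 1) * aperyTerm (n + 1) n =
        (-1) ^ n * (n ! : ℝ) ^ 2 * ((n - n)! : ℝ) /
          ((n + 1 : ℝ) ^ 2 * ((n + 1 + n)! : ℝ)) := by
      rw [hc, aperyTerm, Nat.sub_self, Nat.sub_self,
        show n + 1 + (n + 1) = 2 * n + 1 + 1 by omega, show n + 1 + n = 2 * n + 1 by omega,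
        Nat.factorial_succ (2 * n + 1), Nat.factorial_succ n]
      have h1 : ((2 * n + 1)! : ℝ) ≠ 0 := by positivity
      have h2 : (n ! : ℝ) ≠ 0 := by positivity
      have h3 : (2 * n + 1 + 1 : ℝ) ≠ 0 := by positivity
      push_cast
      field_simp
      simp only [Nat.factorial_zero, Nat.cast_one]
      ring
    rw [sum_range_succ, sum_range_succ, sum_range_succ, ih]
    linarith

theorem factorial_succ_mul_factorial_succ_le (n i : ℕ) :
    (i + 1)! * (n + 1)! ≤ (n + (i + 1))! := by
  induction i with
  | zero => simp
  | succ i ih =>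
    rw [Nat.factorial_succ (i + 1), ← Nat.add_assoc n (i + 1) 1, Nat.factorial_succ (n + (i + 1)),
      Nat.mul_assoc]
    exact Nat.mul_le_mul (by omega) ih

theorem aperyTerm_nonneg (n i : ℕ) : 0 ≤ aperyTerm n i := by
  unfold aperyTerm
  positivity

theorem aperyTerm_le {n i : ℕ} (hi : i < n) :
    aperyTerm n i ≤ 1 / (n + 1 : ℝ) * (1 / (i + 1 : ℝ) ^ 3) := by
  obtain ⟨j, rfl⟩ := Nat.exists_eq_add_of_le (Nat.succ_le_of_lt hi)
  have h1 : (i + 1)! * j ! ≤ (i + 1 + j)! :=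
    Nat.le_of_dvd (Nat.factorial_pos _) (Nat.factorial_mul_factorial_dvd_factorial_add _ _)
  have h2 := factorial_succ_mul_factorial_succ_le (i + 1 + j) i
  have h3 : (i + 1)! ^ 2 * j ! * (i + 1 + j + 1) ≤ (i + 1 + j + (i + 1))! :=
    calc (i + 1)! ^ 2 * j ! * (i + 1 + j + 1)
        = (i + 1)! * ((i + 1 + j + 1) * ((i + 1)! * j !)) := by ring
      _ ≤ (i + 1)! * ((i + 1 + j + 1) * (i + 1 + j)!) := by gcongr
      _ = (i + 1)! * (i + 1 + j + 1)! := by rw [Nat.factorial_succ (i + 1 + j)]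
      _ ≤ _ := h2
  have h4 : ((i + 1)! : ℝ) ^ 2 * (j ! : ℝ) * (((i + 1 + j : ℕ) : ℝ) + 1) ≤
      ((i + 1 + j + (i + 1))! : ℝ) := by exact_mod_cast h3
  rw [aperyTerm, Nat.succ_eq_add_one, Nat.add_sub_cancel_left, _root_.div_mul_div_comm, one_mul,
    div_le_div_iff₀ (by positivity) (by positivity), one_mul]
  have h5 : (0 : ℝ) ≤ (i + 1 : ℝ) ^ 3 := by positivity
  have h6 : (0 : ℝ) ≤ ((i + 1 + j + (i + 1))! : ℝ) := by positivity
  nlinarith [mul_le_mul_of_nonneg_right h4 h5, mul_nonneg h6 h5]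

theorem summable_one_div_succ_cube : Summable fun i : ℕ => 1 / (i + 1 : ℝ) ^ 3 := by
  have h := (summable_nat_add_iff (f := fun i : ℕ => 1 / (i : ℝ) ^ 3) 1).2
    (Real.summable_one_div_nat_pow.2 (by norm_num))
  simpa using h

theorem tendsto_sum_aperyTerm :
    Tendsto (fun n : ℕ => ∑ i ∈ range n, (-1 : ℝ) ^ (i + 1) * aperyTerm n i) atTop (𝓝 0) := by
  have hlim : Tendsto (fun n : ℕ => 1 / (n + 1 : ℝ) * ∑' i : ℕ, 1 / (i + 1 : ℝ) ^ 3)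
      atTop (𝓝 0) := by
    simpa only [zero_mul] using (tendsto_one_div_add_atTop_nhds_zero_nat (𝕜 := ℝ)).mul_const
      (∑' i : ℕ, 1 / (i + 1 : ℝ) ^ 3)
  refine squeeze_zero_norm (fun n => ?_) hlim
  calc ‖∑ i ∈ range n, (-1 : ℝ) ^ (i + 1) * aperyTerm n i‖
      ≤ ∑ i ∈ range n, 1 / (n + 1 : ℝ) * (1 / (i + 1 : ℝ) ^ 3) := by
        refine norm_sum_le_of_le _ fun i hi => ?_
        rw [norm_mul, norm_pow, norm_neg, norm_one, one_pow, one_mul,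
          Real.norm_of_nonneg (aperyTerm_nonneg n i)]
        exact aperyTerm_le (mem_range.1 hi)
    _ ≤ _ := by
        rw [← mul_sum]
        gcongr
        exact summable_one_div_succ_cube.sum_le_tsum _ fun i _ => by positivity

theorem summable_central_binomial_series : Summable fun n : ℕ =>
    (-1 : ℝ) ^ n / ((n + 1 : ℝ) ^ 3 * (Nat.choose (2 * (n + 1)) (n + 1) : ℝ)) := by
  refine Summable.of_norm_bounded summable_one_div_succ_cube fun n => ?_
  have hc : (1 : ℝ) ≤ (Nat.choose (2 * (n + 1)) (n + 1) : ℝ) := by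
    exact_mod_cast Nat.choose_pos (by omega)
  rw [norm_div, norm_pow, norm_neg, norm_one, one_pow, Real.norm_of_nonneg (by positivity)]
  gcongr
  exact le_mul_of_one_le_right (by positivity) hc

/-- `ζ(3) = (5/2) ∑_{n ≥ 1} (-1)^{n-1} / (n³ C(2n,n))`. -/
theorem zeta3_central_binomial_series :
    zetaR 3 = 5 / 2 * ∑' n : ℕ,
      (-1 : ℝ) ^ n / ((n + 1 : ℝ) ^ 3 * (Nat.choose (2 * (n + 1)) (n + 1) : ℝ)) := by
  have h1 := summable_one_div_succ_cube.hasSum.tendsto_sum_nat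
  have h2 := (summable_central_binomial_series.hasSum.tendsto_sum_nat.const_mul (5 / 2)).add
    tendsto_sum_aperyTerm
  simp only [← sum_one_div_cube_eq, add_zero] at h2
  exact tendsto_nhds_unique h1 h2
end

section
/- The Apéry sequences (u_n) and (v_n) both satisfy the linear recurrence (n+1)³·y_{n+1} − (34n³ + 51n² + 27n + 5)·y_n + n³·y_{n−1} = 0 for all n ≥ 1. -/
/-- The first Apéry sequence `u_n = ∑_{k=0}^n C(n,k)² C(n+k,k)²`. -/
def aperyU (n : ℕ) : ℚ :=
  ∑ k ∈ Finset.range (n + 1), (n.choose k : ℚ) ^ 2 * ((n + k).choose k : ℚ) ^ 2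

/-- The second Apéry sequence
`v_n = ∑_{k=0}^n C(n,k)² C(n+k,k)² (∑_{m=1}^n 1/m³ + ∑_{m=1}^k (-1)^{m-1}/(2m³ C(n,m) C(n+m,m)))`. -/
def aperyV (n : ℕ) : ℚ :=
  ∑ k ∈ Finset.range (n + 1), (n.choose k : ℚ) ^ 2 * ((n + k).choose k : ℚ) ^ 2 *
    ((∑ m ∈ Finset.Icc 1 n, 1 / (m : ℚ) ^ 3) +
      ∑ m ∈ Finset.Icc 1 k,
        (-1 : ℚ) ^ (m - 1) / (2 * (m : ℚ) ^ 3 * (n.choose m : ℚ) * ((n + m).choose m : ℚ)))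

/-- The product `C(n,k) C(n+k,k)`. -/
def aperyT (n k : ℕ) : ℚ := (n.choose k : ℚ) * ((n + k).choose k : ℚ)

/-- The inner factor `∑_{m=1}^n 1/m³ + ∑_{m=1}^k (-1)^{m-1}/(2m³ C(n,m) C(n+m,m))` of `aperyV`. -/
def aperyC (n k : ℕ) : ℚ :=
  (∑ m ∈ Finset.Icc 1 n, 1 / (m : ℚ) ^ 3) +
    ∑ m ∈ Finset.Icc 1 k,
      (-1 : ℚ) ^ (m - 1) / (2 * (m : ℚ) ^ 3 * (n.choose m : ℚ) * ((n + m).choose m : ℚ))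

@[simp] lemma aperyT_zero_right (n : ℕ) : aperyT n 0 = 1 := by simp [aperyT]

lemma aperyT_eq_zero {n k : ℕ} (h : n < k) : aperyT n k = 0 := by
  simp [aperyT, Nat.choose_eq_zero_of_lt h]

lemma aperyT_ne_zero {n k : ℕ} (h : k ≤ n) : aperyT n k ≠ 0 := by
  have h₁ := (Nat.choose_pos h).ne'
  have h₂ := (Nat.choose_pos (Nat.le_add_left k n)).ne'
  simp only [aperyT]
  positivity

lemma aperyT_succ_right (n k : ℕ) :
    aperyT n (k + 1) = ((n : ℚ) - k) * (n + k + 1) / (k + 1) ^ 2 * aperyT n k := by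
  have h₁ : (n.choose (k + 1) : ℚ) * (k + 1) = n.choose k * (n - k) := by
    rcases le_or_gt k n with h | h
    · have := Nat.choose_succ_right_eq n k
      rw [← Nat.cast_sub h]
      exact_mod_cast this
    · simp [Nat.choose_eq_zero_of_lt h, Nat.choose_eq_zero_of_lt (h.trans (Nat.lt_succ_self k))]
  have h₂ : ((n + (k + 1)).choose (k + 1) : ℚ) * (k + 1) = (n + k + 1) * (n + k).choose k := by
    exact_mod_cast (Nat.add_one_mul_choose_eq (n + k) k).symm
  have hk : (k : ℚ) + 1 ≠ 0 := by positivity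
  simp only [aperyT]
  field_simp
  linear_combination ((n + (k + 1)).choose (k + 1) : ℚ) * (k + 1) * h₁ +
    n.choose k * ((n : ℚ) - k) * h₂

lemma aperyT_succ_left (n k : ℕ) :
    ((n : ℚ) + 1 - k) * aperyT (n + 1) k = (n + 1 + k) * aperyT n k := by
  induction k with
  | zero => simp
  | succ k ih =>
    rw [aperyT_succ_right, aperyT_succ_right]
    push_cast
    have hk : (k : ℚ) + 1 ≠ 0 := by positivity
    field_simp
    linear_combination ((n : ℚ) - k) * (n + k + 2) * ih

lemma aperyT_succ_succ (n k : ℕ) :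
    aperyT (n + 1) (k + 1) = ((n : ℚ) + k + 2) * (n + k + 1) / (k + 1) ^ 2 * aperyT n k := by
  rw [aperyT_succ_right]
  have hk : (k : ℚ) + 1 ≠ 0 := by positivity
  push_cast
  field_simp
  linear_combination ((n : ℚ) + k + 2) * aperyT_succ_left n k

lemma aperyT_pred_succ (n k : ℕ) :
    aperyT n (k + 1) = ((n : ℚ) + 1 - k) * (n - k) / (k + 1) ^ 2 * aperyT (n + 1) k := by
  rw [aperyT_succ_right]
  have hk : (k : ℚ) + 1 ≠ 0 := by positivity
  field_simp
  linear_combination -((n : ℚ) - k) * aperyT_succ_left n k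

lemma aperyC_succ_right (n k : ℕ) :
    aperyC n (k + 1) = aperyC n k + (-1) ^ k / (2 * ((k : ℚ) + 1) ^ 3 * aperyT n (k + 1)) := by
  simp only [aperyC, aperyT]
  rw [Finset.sum_Icc_succ_top (Nat.le_add_left 1 k)]
  simp only [Nat.add_sub_cancel]
  push_cast
  ring

lemma aperyC_succ_left {n k : ℕ} (h : k ≤ n) :
    aperyC (n + 1) k =
      aperyC n k + (-1) ^ k / (((n : ℚ) + 1) ^ 2 * (n + 1 + k) * aperyT n k) := by
  induction k with
  | zero =>
    simp only [aperyC]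
    rw [Finset.sum_Icc_succ_top (Nat.le_add_left 1 n)]
    simp
    field_simp
  | succ k ih =>
    have ht := aperyT_ne_zero (n := n) (k := k) (by omega)
    rw [aperyC_succ_right, aperyC_succ_right, ih (by omega), aperyT_succ_succ, aperyT_succ_right]
    obtain ⟨d, rfl⟩ : ∃ d, n = k + 1 + d := ⟨n - (k + 1), by omega⟩
    generalize aperyT (k + 1 + d) k = t at *
    push_cast
    have h₀ : (k : ℚ) + 1 ≠ 0 := by positivity
    have h₁ : (k : ℚ) + 1 + d - k ≠ 0 := by ring_nf; positivity
    have h₂ : (k : ℚ) + 1 + d + k + 1 ≠ 0 := by positivity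
    have h₃ : (k : ℚ) + 1 + d + k + 2 ≠ 0 := by positivity
    have h₄ : (k : ℚ) + 1 + d + 1 + (k + 1) ≠ 0 := by positivity
    have h₅ : (k : ℚ) + 1 + d + 1 + k ≠ 0 := by positivity
    have h₆ : (k : ℚ) + 1 + d + 1 ≠ 0 := by positivity
    field_simp
    ring

/-- Telescoping certificate for `aperyU`. -/
lemma sum_aperyT_recurrence (n K : ℕ) :
    ∑ k ∈ Finset.range (K + 1), (((n : ℚ) + 2) ^ 3 * aperyT (n + 2) k ^ 2 -
        (34 * ((n : ℚ) + 1) ^ 3 + 51 * (n + 1) ^ 2 + 27 * (n + 1) + 5) * aperyT (n + 1) k ^ 2 +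
        ((n : ℚ) + 1) ^ 3 * aperyT n k ^ 2) =
      4 * (2 * (n : ℚ) + 3) * (K * (2 * K + 1) - (2 * n + 3) ^ 2) * aperyT (n + 1) K ^ 2 := by
  induction K with
  | zero => simp; ring
  | succ K ih =>
    rw [Finset.sum_range_succ, ih, aperyT_succ_succ (n + 1), aperyT_succ_right (n + 1),
      aperyT_pred_succ]
    have hk : (K : ℚ) + 1 ≠ 0 := by positivity
    push_cast
    field_simp
    ring

/-- Telescoping certificate for `aperyV`. -/
lemma sum_aperyT_mul_aperyC_recurrence {n K : ℕ} (h : K ≤ n + 1) :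
    ∑ k ∈ Finset.range (K + 1), (((n : ℚ) + 2) ^ 3 * (aperyT (n + 2) k ^ 2 * aperyC (n + 2) k) -
        (34 * ((n : ℚ) + 1) ^ 3 + 51 * (n + 1) ^ 2 + 27 * (n + 1) + 5) *
          (aperyT (n + 1) k ^ 2 * aperyC (n + 1) k) +
        ((n : ℚ) + 1) ^ 3 * (aperyT n k ^ 2 * aperyC n k)) =
      4 * (2 * (n : ℚ) + 3) * (K * (2 * K + 1) - (2 * n + 3) ^ 2) * aperyT (n + 1) K ^ 2 *
          aperyC (n + 1) K -
        5 * (2 * (n : ℚ) + 3) * (-1) ^ K * K / ((n + 1) * (n + 2)) * aperyT (n + 1) K := by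
  induction K with
  | zero =>
    have h₁ : (n : ℚ) + 1 ≠ 0 := by positivity
    have h₂ : (n : ℚ) + 1 + 1 ≠ 0 := by positivity
    simp [aperyC_succ_left (Nat.zero_le (n + 1)), aperyC_succ_left (Nat.zero_le n)]
    field_simp
    ring
  | succ K ih =>
    have lower : aperyT n (K + 1) ^ 2 * aperyC n (K + 1) =
        aperyT n (K + 1) ^ 2 * aperyC (n + 1) (K + 1) +
          (-1) ^ K * aperyT n (K + 1) / (((n : ℚ) + 1) ^ 2 * (n + 2 + K)) := by
      rcases Nat.lt_or_ge n (K + 1) with h' | h'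
      · simp [aperyT_eq_zero h']
      · have ht := aperyT_ne_zero h'
        rw [aperyC_succ_left h']
        have h₁ : (n : ℚ) + 2 + K ≠ 0 := by positivity
        have h₂ : (n : ℚ) + 1 + (K + 1) ≠ 0 := by positivity
        push_cast
        field_simp
        ring
    have ht := aperyT_ne_zero (n := n + 1) (k := K) (by omega)
    have h₀ : (K : ℚ) + 1 ≠ 0 := by positivity
    have h₁ : (n : ℚ) + 1 - K ≠ 0 := by
      have : (K : ℚ) + 1 ≤ n + 1 := by exact_mod_cast h
      linarith
    have h₂ : (n : ℚ) + 2 + K ≠ 0 := by positivity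
    have h₃ : (n : ℚ) + 3 + K ≠ 0 := by positivity
    have h₅ : (n : ℚ) + 2 ≠ 0 := by positivity
    have h₆ : (n : ℚ) + 1 ≠ 0 := by positivity
    have right : aperyT (n + 1) (K + 1) =
        ((n : ℚ) + 1 - K) * (n + 2 + K) / (K + 1) ^ 2 * aperyT (n + 1) K := by
      rw [aperyT_succ_right]
      push_cast
      ring
    have diag : aperyT (n + 2) (K + 1) =
        ((n : ℚ) + 3 + K) * (n + 2 + K) / (K + 1) ^ 2 * aperyT (n + 1) K := by
      rw [aperyT_succ_succ]
      push_cast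
      ring
    have middle : aperyC (n + 1) (K + 1) = aperyC (n + 1) K +
        (-1) ^ K / (2 * ((K : ℚ) + 1) * ((n + 1 - K) * (n + 2 + K) * aperyT (n + 1) K)) := by
      rw [aperyC_succ_right, right]
      field_simp
    have upper : aperyC (n + 2) (K + 1) = aperyC (n + 1) (K + 1) -
        (-1) ^ K * (K + 1) ^ 2 /
          (((n : ℚ) + 2) ^ 2 * (n + 3 + K) * (n + 1 - K) * (n + 2 + K) * aperyT (n + 1) K) := by
      rw [aperyC_succ_left h, right, pow_succ]
      push_cast
      rw [show (n : ℚ) + 1 + 1 = n + 2 by ring, show (n : ℚ) + 2 + (K + 1) = n + 3 + K by ring]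
      field_simp
      ring
    rw [Finset.sum_range_succ, ih (by omega), lower, upper, middle, diag, right,
      aperyT_pred_succ, pow_succ (-1 : ℚ)]
    generalize aperyT (n + 1) K = t at *
    generalize aperyC (n + 1) K = c
    generalize (-1 : ℚ) ^ K = e at *
    push_cast
    field_simp
    ring

lemma aperyU_eq_sum {n N : ℕ} (h : n ≤ N) :
    aperyU n = ∑ k ∈ Finset.range (N + 1), aperyT n k ^ 2 := by
  rw [aperyU, ← Finset.sum_subset (Finset.range_mono (Nat.succ_le_succ h))]
  · simp only [aperyT, mul_pow]
  · intro k _ hk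
    rw [aperyT_eq_zero (by simpa using hk)]
    ring

lemma aperyV_eq_sum {n N : ℕ} (h : n ≤ N) :
    aperyV n = ∑ k ∈ Finset.range (N + 1), aperyT n k ^ 2 * aperyC n k := by
  rw [aperyV, ← Finset.sum_subset (Finset.range_mono (Nat.succ_le_succ h))]
  · simp only [aperyT, aperyC, mul_pow]
  · intro k _ hk
    rw [aperyT_eq_zero (by simpa using hk)]
    ring

/-- The Apéry sequences `(u_n)` and `(v_n)` both satisfy the recurrence
`(n+1)³ y_{n+1} - (34n³ + 51n² + 27n + 5) y_n + n³ y_{n-1} = 0` for `n ≥ 1`. -/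
theorem apery_recurrence (n : ℕ) (hn : 1 ≤ n) :
    ((n : ℚ) + 1) ^ 3 * aperyU (n + 1) -
        (34 * (n : ℚ) ^ 3 + 51 * (n : ℚ) ^ 2 + 27 * (n : ℚ) + 5) * aperyU n +
        (n : ℚ) ^ 3 * aperyU (n - 1) = 0 ∧
    ((n : ℚ) + 1) ^ 3 * aperyV (n + 1) -
        (34 * (n : ℚ) ^ 3 + 51 * (n : ℚ) ^ 2 + 27 * (n : ℚ) + 5) * aperyV n +
        (n : ℚ) ^ 3 * aperyV (n - 1) = 0 := by
  obtain ⟨n, rfl⟩ := Nat.exists_eq_add_of_le' hn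
  have e : ((n + 1 : ℕ) : ℚ) + 1 = n + 2 := by push_cast; ring
  constructor
  · have key := sum_aperyT_recurrence n (n + 2)
    rw [aperyT_eq_zero (Nat.lt_succ_self (n + 1))] at key
    simp only [Finset.sum_add_distrib, Finset.sum_sub_distrib, ← Finset.mul_sum] at key
    rw [Nat.add_sub_cancel, aperyU_eq_sum (le_refl (n + 1 + 1)),
      aperyU_eq_sum (Nat.le_succ (n + 1)), aperyU_eq_sum (by omega : n ≤ n + 1 + 1), e]
    push_cast at key ⊢
    linear_combination key
  · have key := sum_aperyT_mul_aperyC_recurrence (le_refl (n + 1))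
    simp only [Finset.sum_add_distrib, Finset.sum_sub_distrib, ← Finset.mul_sum] at key
    rw [Nat.add_sub_cancel, aperyV_eq_sum (le_refl (n + 1 + 1)),
      aperyV_eq_sum (le_refl (n + 1)), aperyV_eq_sum (Nat.le_succ n), e,
      Finset.sum_range_succ _ (n + 1 + 1)]
    have ht := aperyT_ne_zero (le_refl (n + 1))
    have last : ((n : ℚ) + 2) ^ 3 * (aperyT (n + 2) (n + 2) ^ 2 * aperyC (n + 2) (n + 2)) =
        -(4 * (2 * (n : ℚ) + 3) * ((n + 1) * (2 * (n + 1) + 1) - (2 * n + 3) ^ 2) *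
          aperyT (n + 1) (n + 1) ^ 2 * aperyC (n + 1) (n + 1) -
        5 * (2 * (n : ℚ) + 3) * (-1) ^ (n + 1) * (n + 1) / ((n + 1) * (n + 2)) *
          aperyT (n + 1) (n + 1)) := by
      rw [aperyC_succ_right (n + 2) (n + 1), aperyC_succ_left (le_refl (n + 1)),
        aperyT_succ_succ (n + 1) (n + 1)]
      generalize aperyT (n + 1) (n + 1) = t at *
      generalize aperyC (n + 1) (n + 1) = c
      push_cast
      have h₁ : (n : ℚ) + 1 + 1 ≠ 0 := by positivity
      have h₂ : (n : ℚ) + 2 ≠ 0 := by positivity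
      have h₃ : (n : ℚ) + 1 ≠ 0 := by positivity
      have h₄ : (n : ℚ) + 1 + 1 + (n + 1) ≠ 0 := by positivity
      have h₅ : (n : ℚ) + 1 + (n + 1) + 2 ≠ 0 := by positivity
      have h₆ : (n : ℚ) + 1 + (n + 1) + 1 ≠ 0 := by positivity
      field_simp
      ring
    push_cast at key ⊢
    linear_combination key + last
end
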